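/- Let F be a Finsler metric on an open set U ⊆ ℝⁿ (n ≥ 2) which is of sectional flag curvature. Then for every point x ∈ U, at least one of the following holds: (1) the Minkowski norm F(x,·) is Euclidean, i.e. there exists a symmetric positive definite matrix (a_{ij}) with F(x, y)² = a_{ij}y^iy^j for all y ≠ 0; or (2) the flag curvature is isotropic at x. -/

import Mathlib

open scoped BigOperators
open MeasureTheory

noncomputable section

namespace Paper

/-- `E n` is the model space ℝⁿ. -/
abbrev E (n : ℕ) := Fin n → ℝ

/-- `e n i` is the `i`-th standard basis vector of ℝⁿ. -/
def e (n : ℕ) (i : Fin n) : E n := Pi.single i 1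

/-- Partial derivative of `f(x,y)` in the fiber variable `y^i`. -/
def pdy (n : ℕ) (f : E n → E n → ℝ) (i : Fin n) : E n → E n → ℝ :=
  fun x y => fderiv ℝ (f x) y (e n i)

/-- Partial derivative of `f(x,y)` in the base variable `x^k`. -/
def pdx (n : ℕ) (f : E n → E n → ℝ) (k : Fin n) : E n → E n → ℝ :=
  fun x y => fderiv ℝ (fun x' => f x' y) x (e n k)

/-- The square `F²` of the metric. -/
def F2 (n : ℕ) (F : E n → E n → ℝ) : E n → E n → ℝ := fun x y => (F x y) ^ 2

/-- Fundamental tensor `g_{ij} = ½ [F²]_{y^i y^j}`. -/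
def gm (n : ℕ) (F : E n → E n → ℝ) (i j : Fin n) : E n → E n → ℝ :=
  fun x y => (1 / 2 : ℝ) * pdy n (pdy n (F2 n F) j) i x y

/-- The fundamental tensor as a matrix. -/
def gmat (n : ℕ) (F : E n → E n → ℝ) (x y : E n) : Matrix (Fin n) (Fin n) ℝ :=
  Matrix.of fun i j => gm n F i j x y

/-- The inverse fundamental tensor `g^{ij}`. -/
def ginv (n : ℕ) (F : E n → E n → ℝ) (x y : E n) : Matrix (Fin n) (Fin n) ℝ :=
  (gmat n F x y)⁻¹

/-- `F_{y^i}`. -/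
def Fy (n : ℕ) (F : E n → E n → ℝ) (i : Fin n) : E n → E n → ℝ := pdy n F i

/-- Angular metric `h_{ij} = g_{ij} - F_{y^i} F_{y^j}`. -/
def hm (n : ℕ) (F : E n → E n → ℝ) (i j : Fin n) : E n → E n → ℝ :=
  fun x y => gm n F i j x y - Fy n F i x y * Fy n F j x y

/-- Cartan tensor `C_{ijk} = ¼ [F²]_{y^i y^j y^k}`. -/
def Cartan (n : ℕ) (F : E n → E n → ℝ) (i j k : Fin n) : E n → E n → ℝ :=
  fun x y => (1 / 4 : ℝ) * pdy n (pdy n (pdy n (F2 n F) k) j) i x y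

/-- Mean Cartan tensor `I_i = g^{jk} C_{ijk}`. -/
def meanCartan (n : ℕ) (F : E n → E n → ℝ) (i : Fin n) : E n → E n → ℝ :=
  fun x y => ∑ j, ∑ k, ginv n F x y j k * Cartan n F i j k x y

/-- Matsumoto torsion `M_{ijk}`. -/
def Matsumoto (n : ℕ) (F : E n → E n → ℝ) (i j k : Fin n) : E n → E n → ℝ :=
  fun x y => Cartan n F i j k x y -
    (1 / ((n : ℝ) + 1)) * (hm n F i j x y * meanCartan n F k x y +
      hm n F j k x y * meanCartan n F i x y + hm n F k i x y * meanCartan n F j x y)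

/-- Spray coefficients `G^i = ¼ g^{il} ([F²]_{x^k y^l} y^k - [F²]_{x^l})`. -/
def Spray (n : ℕ) (F : E n → E n → ℝ) (i : Fin n) : E n → E n → ℝ :=
  fun x y => (1 / 4 : ℝ) * ∑ l, ginv n F x y i l *
    ((∑ k, pdx n (pdy n (F2 n F) l) k x y * y k) - pdx n (F2 n F) l x y)

/-- Riemann curvature `R^i_k`. -/
def RiemUp (n : ℕ) (F : E n → E n → ℝ) (i k : Fin n) : E n → E n → ℝ :=
  fun x y =>
    2 * pdx n (Spray n F i) k x y
    - (∑ j, y j * pdx n (pdy n (Spray n F i) k) j x y)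
    + 2 * (∑ j, Spray n F j x y * pdy n (pdy n (Spray n F i) k) j x y)
    - ∑ j, pdy n (Spray n F i) j x y * pdy n (Spray n F j) k x y

/-- Riemann curvature with lowered index `R_{jk} = g_{ij} R^i_k`. -/
def Rlow (n : ℕ) (F : E n → E n → ℝ) (j k : Fin n) : E n → E n → ℝ :=
  fun x y => ∑ i, gm n F i j x y * RiemUp n F i k x y

/-- Flag curvature `K(x,y,v)`. -/
def K (n : ℕ) (F : E n → E n → ℝ) (x y v : E n) : ℝ :=
  (∑ j, ∑ k, Rlow n F j k x y * v j * v k) /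
    ((F x y) ^ 2 * ∑ j, ∑ k, hm n F j k x y * v j * v k)

/-- `F` is a Finsler metric on the open set `U ⊆ ℝⁿ`. -/
structure IsFinsler (n : ℕ) (U : Set (E n)) (F : E n → E n → ℝ) : Prop where
  smooth : ContDiffOn ℝ (⊤ : ℕ∞) (fun p : E n × E n => F p.1 p.2) (U ×ˢ {y : E n | y ≠ 0})
  pos : ∀ x ∈ U, ∀ y : E n, y ≠ 0 → 0 < F x y
  homog : ∀ x ∈ U, ∀ y : E n, y ≠ 0 → ∀ c : ℝ, 0 < c → F x (c • y) = c * F x y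
  posdef : ∀ x ∈ U, ∀ y : E n, y ≠ 0 → (gmat n F x y).PosDef

/-- `F` is of sectional flag curvature: `K` only depends on the section. -/
def SectionalFlagCurv (n : ℕ) (U : Set (E n)) (F : E n → E n → ℝ) : Prop :=
  ∀ x ∈ U, ∀ y v y' v' : E n,
    LinearIndependent ℝ ![y, v] → LinearIndependent ℝ ![y', v'] →
    Submodule.span ℝ {y, v} = Submodule.span ℝ {y', v'} →
    K n F x y v = K n F x y' v'

/-- The flag curvature is isotropic at `x`. -/
def IsotropicAt (n : ℕ) (F : E n → E n → ℝ) (x : E n) : Prop :=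
  ∃ c : ℝ, ∀ y v : E n, LinearIndependent ℝ ![y, v] → K n F x y v = c

/-- The spray vector field `G = y^i ∂/∂x^i - 2G^i ∂/∂y^i` acting on a function of `(x,y)`. -/
def Gop (n : ℕ) (F f : E n → E n → ℝ) : E n → E n → ℝ :=
  fun x y => (∑ i, y i * pdx n f i x y) - 2 * ∑ i, Spray n F i x y * pdy n f i x y

/-- Dynamical derivative of a 1-index tensor. -/
def Dyn1 (n : ℕ) (F : E n → E n → ℝ) (T : Fin n → E n → E n → ℝ) (i : Fin n) :
    E n → E n → ℝ :=
  fun x y => Gop n F (T i) x y - ∑ m, pdy n (Spray n F m) i x y * T m x y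

/-- Dynamical derivative of a 2-index tensor. -/
def Dyn2 (n : ℕ) (F : E n → E n → ℝ) (T : Fin n → Fin n → E n → E n → ℝ) (i j : Fin n) :
    E n → E n → ℝ :=
  fun x y => Gop n F (T i j) x y - (∑ m, pdy n (Spray n F m) i x y * T m j x y)
    - ∑ m, pdy n (Spray n F m) j x y * T i m x y

/-- Dynamical derivative of a 3-index tensor. -/
def Dyn3 (n : ℕ) (F : E n → E n → ℝ) (T : Fin n → Fin n → Fin n → E n → E n → ℝ)
    (i j k : Fin n) : E n → E n → ℝ :=
  fun x y => Gop n F (T i j k) x y - (∑ m, pdy n (Spray n F m) i x y * T m j k x y)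
    - (∑ m, pdy n (Spray n F m) j x y * T i m k x y)
    - ∑ m, pdy n (Spray n F m) k x y * T i j m x y

/-- `y` is a polar direction at `x`: `R_{jk} = κ F² h_{jk}` for some constant `κ`. -/
def IsPolarDir (n : ℕ) (F : E n → E n → ℝ) (x y : E n) : Prop :=
  ∃ κ : ℝ, ∀ j k : Fin n, Rlow n F j k x y = κ * (F x y) ^ 2 * hm n F j k x y



section Core
open scoped ContDiff Topology

/-- The total space of triples `(x, y, v)`. -/
abbrev T (n : ℕ) := E n × E n × E n

/-- Admissible triples. -/
def OO (n : ℕ) (U : Set (E n)) : Set (T n) := {p | p.1 ∈ U ∧ p.2.1 ≠ 0}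

lemma isOpen_OO {n : ℕ} {U : Set (E n)} (hU : IsOpen U) : IsOpen (OO n U) := by
  have h1 : IsOpen {p : T n | p.1 ∈ U} := hU.preimage continuous_fst
  have h2 : IsOpen {p : T n | p.2.1 ≠ 0} :=
    isOpen_ne.preimage (continuous_fst.comp continuous_snd)
  exact h1.inter h2

variable {n : ℕ} {M : Type*} [NormedAddCommGroup M] [NormedSpace ℝ M]

/-- Derivative of `f` along the vector field `X`. -/
def L (X : T n → T n) (f : T n → M) : T n → M := fun p => fderiv ℝ f p (X p)

lemma L_smooth {O : Set (T n)} (hO : IsOpen O) {X : T n → T n} {f : T n → M}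
    (hX : ContDiffOn ℝ ∞ X O) (hf : ContDiffOn ℝ ∞ f O) : ContDiffOn ℝ ∞ (L X f) O :=
  (hf.fderiv_of_isOpen hO (by simp)).clm_apply hX

lemma diffAt {O : Set (T n)} (hO : IsOpen O) {f : T n → M} (hf : ContDiffOn ℝ ∞ f O)
    {p : T n} (hp : p ∈ O) : DifferentiableAt ℝ f p :=
  (hf.contDiffAt (hO.mem_nhds hp)).differentiableAt (by simp)

lemma L_congr {O : Set (T n)} (hO : IsOpen O) {f g : T n → M} (h : ∀ p ∈ O, f p = g p)
    {p : T n} (hp : p ∈ O) (w : T n) : fderiv ℝ f p w = fderiv ℝ g p w := by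
  have : f =ᶠ[𝓝 p] g := by
    filter_upwards [hO.mem_nhds hp] with q hq using h q hq
  rw [this.fderiv_eq]

lemma L_comm {O : Set (T n)} (hO : IsOpen O) {X Y : T n → T n} {f : T n → M}
    (hX : ContDiffOn ℝ ∞ X O) (hY : ContDiffOn ℝ ∞ Y O) (hf : ContDiffOn ℝ ∞ f O)
    {p : T n} (hp : p ∈ O) :
    L X (L Y f) p = L Y (L X f) p + fderiv ℝ f p (fderiv ℝ Y p (X p) - fderiv ℝ X p (Y p)) := by
  have hdf : DifferentiableAt ℝ (fderiv ℝ f) p :=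
    ((hf.fderiv_of_isOpen hO (m := ∞) (by simp)).contDiffAt (hO.mem_nhds hp)).differentiableAt
      (by simp)
  have key : ∀ (Z : T n → T n) (_ : ContDiffOn ℝ ∞ Z O) (w : T n),
      fderiv ℝ (L Z f) p w = fderiv ℝ (fderiv ℝ f) p w (Z p) + fderiv ℝ f p (fderiv ℝ Z p w) := by
    intro Z hZ w
    have : fderiv ℝ (L Z f) p = _ := fderiv_clm_apply hdf (diffAt hO hZ hp)
    rw [this]
    simp [add_comm]
  have hs : IsSymmSndFDerivAt ℝ f p :=
    (hf.contDiffAt (hO.mem_nhds hp)).isSymmSndFDerivAt (by simpa using WithTop.coe_le_coe.2 (le_top : (2 : ℕ∞) ≤ ⊤))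
  change fderiv ℝ (L Y f) p (X p) = fderiv ℝ (L X f) p (Y p) + _
  rw [key Y hY, key X hX, map_sub, hs.eq (X p) (Y p)]
  abel

lemma L_zero {O : Set (T n)} (hO : IsOpen O) {f : T n → M} (h : ∀ p ∈ O, f p = 0)
    {p : T n} (hp : p ∈ O) (w : T n) : fderiv ℝ f p w = 0 := by
  rw [L_congr hO (g := fun _ => 0) h hp]; simp

/-- `f` does not depend on `v`. -/
def NoV (f : T n → M) : Prop := ∀ p : T n, f p = f (p.1, p.2.1, 0)

lemma NoV.fderiv_eq {O : Set (T n)} (hO : IsOpen O) {f : T n → M} (hf : ContDiffOn ℝ ∞ f O)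
    (h : NoV f) {p : T n} (hp : p ∈ O) (w : E n) : fderiv ℝ f p (0, 0, w) = 0 := by
  have h1 := (diffAt hO hf hp).hasFDerivAt
  have h2 : HasDerivAt (fun t : ℝ => f (p + t • ((0, 0, w) : T n))) (fderiv ℝ f p (0,0,w)) 0 := by
    exact h1.hasLineDerivAt _
  have h3 : (fun t : ℝ => f (p + t • ((0, 0, w) : T n))) = fun _ => f p := by
    funext t
    rw [h, h p]; simp
  rw [h3] at h2
  exact h2.unique (hasDerivAt_const _ _)

/-- The vertical field `v^i ∂/∂y^i`. -/
def Vf (n : ℕ) : T n →L[ℝ] T n :=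
  (0 : T n →L[ℝ] E n).prod
    (((ContinuousLinearMap.snd ℝ (E n) (E n)).comp (ContinuousLinearMap.snd ℝ (E n) (E n × E n))).prod
    (0 : T n →L[ℝ] E n))

def Yf (n : ℕ) : T n →L[ℝ] T n :=
  (0 : T n →L[ℝ] E n).prod
    (((ContinuousLinearMap.fst ℝ (E n) (E n)).comp (ContinuousLinearMap.snd ℝ (E n) (E n × E n))).prod
    (0 : T n →L[ℝ] E n))

@[simp] lemma Vf_apply (p : T n) : Vf n p = (0, p.2.2, 0) := rfl
@[simp] lemma Yf_apply (p : T n) : Yf n p = (0, p.2.1, 0) := rfl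

def Df (G : T n → E n) : T n → T n := fun p => (p.2.1, (-2 : ℝ) • G p, - L (Vf n) G p)
def Hf (G : T n → E n) : T n → T n := fun p => (p.2.2, - L (Vf n) G p, - L (Vf n) (L (Vf n) G) p)

/-- The curvature applied to `v`. -/
def Rv (G : T n → E n) : T n → E n := fun p => (2 : ℝ) • L (Hf G) G p - L (Df G) (L (Vf n) G) p

structure Setup (U : Set (E n)) (Q : T n → ℝ) (G : T n → E n) : Prop where
  hU : IsOpen U
  hQ : ContDiffOn ℝ ∞ Q (OO n U)
  hG : ContDiffOn ℝ ∞ G (OO n U)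
  nQ : NoV Q
  nG : NoV G
  euler : ∀ p ∈ OO n U, L (Yf n) Q p = 2 * Q p
  el : ∀ p ∈ OO n U, fderiv ℝ (L (Vf n) Q) p (p.2.1, (-2 : ℝ) • G p, 0) =
    fderiv ℝ Q p (p.2.2, 0, 0)

namespace Setup
variable {U : Set (E n)} {Q : T n → ℝ} {G : T n → E n} (S : Setup U Q G)
include S

lemma op : IsOpen (OO n U) := isOpen_OO S.hU

lemma sV (f : T n → M) (hf : ContDiffOn ℝ ∞ f (OO n U)) :
    ContDiffOn ℝ ∞ (L (Vf n) f) (OO n U) := L_smooth S.op (Vf n).contDiff.contDiffOn hf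

lemma sD : ContDiffOn ℝ ∞ (Df G) (OO n U) := by
  have h1 := S.hG
  have h2 := S.sV G S.hG
  unfold Df
  fun_prop

lemma sH : ContDiffOn ℝ ∞ (Hf G) (OO n U) := by
  have h2 := S.sV G S.hG
  have h3 := S.sV _ h2
  unfold Hf
  fun_prop

lemma sLD (f : T n → M) (hf : ContDiffOn ℝ ∞ f (OO n U)) :
    ContDiffOn ℝ ∞ (L (Df G) f) (OO n U) := L_smooth S.op S.sD hf
lemma sLH (f : T n → M) (hf : ContDiffOn ℝ ∞ f (OO n U)) :
    ContDiffOn ℝ ∞ (L (Hf G) f) (OO n U) := L_smooth S.op S.sH hf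

lemma sRv : ContDiffOn ℝ ∞ (Rv G) (OO n U) := by
  have h1 := S.sLH G S.hG
  have h2 := S.sLD _ (S.sV G S.hG)
  unfold Rv
  fun_prop

lemma fD {p : T n} (hp : p ∈ OO n U) (q : T n) : fderiv ℝ (Df G) p q =
    (q.2.1, (-2 : ℝ) • fderiv ℝ G p q, - fderiv ℝ (L (Vf n) G) p q) := by
  have h1 := (diffAt S.op S.hG hp).hasFDerivAt
  have h2 := (diffAt S.op (S.sV G S.hG) hp).hasFDerivAt
  have h0 : HasFDerivAt (fun p : T n => p.2.1) _ p :=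
    ((ContinuousLinearMap.fst ℝ (E n) (E n)).comp
      (ContinuousLinearMap.snd ℝ (E n) (E n × E n))).hasFDerivAt
  have := h0.prodMk ((h1.const_smul (-2 : ℝ)).prodMk h2.neg)
  have h4 : fderiv ℝ (Df G) p = _ := this.fderiv
  rw [h4]; rfl

lemma fH {p : T n} (hp : p ∈ OO n U) (q : T n) : fderiv ℝ (Hf G) p q =
    (q.2.2, - fderiv ℝ (L (Vf n) G) p q, - fderiv ℝ (L (Vf n) (L (Vf n) G)) p q) := by
  have h1 := (diffAt S.op (S.sV _ (S.sV G S.hG)) hp).hasFDerivAt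
  have h2 := (diffAt S.op (S.sV G S.hG) hp).hasFDerivAt
  have h0 : HasFDerivAt (fun p : T n => p.2.2) _ p :=
    ((ContinuousLinearMap.snd ℝ (E n) (E n)).comp
      (ContinuousLinearMap.snd ℝ (E n) (E n × E n))).hasFDerivAt
  have := h0.prodMk (h2.neg.prodMk h1.neg)
  have h4 : fderiv ℝ (Hf G) p = _ := this.fderiv
  rw [h4]; rfl

lemma cDV {f : T n → M} (hf : ContDiffOn ℝ ∞ f (OO n U)) {p : T n} (hp : p ∈ OO n U) :
    L (Df G) (L (Vf n) f) p = L (Vf n) (L (Df G) f) p - L (Hf G) f p := by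
  rw [L_comm S.op S.sD (Vf n).contDiff.contDiffOn hf hp, S.fD hp, sub_eq_add_neg (L _ _ p)]
  congr 1
  change _ = - fderiv ℝ f p (Hf G p)
  rw [← (fderiv ℝ f p).map_neg]
  congr 1
  refine Prod.ext ?_ (Prod.ext ?_ ?_)
  · simp [Df, Hf]
  · simp only [Df, Hf, L, Prod.snd_sub, Prod.fst_sub, ContinuousLinearMap.fderiv, Vf_apply,
      Prod.snd_neg, Prod.fst_neg]
    module
  · simp [Df, Hf, L]

lemma cVH {f : T n → M} (hf : ContDiffOn ℝ ∞ f (OO n U)) {p : T n} (hp : p ∈ OO n U) :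
    L (Vf n) (L (Hf G) f) p = L (Hf G) (L (Vf n) f) p +
      fderiv ℝ f p (0, 0, - L (Vf n) (L (Vf n) (L (Vf n) G)) p) := by
  rw [L_comm S.op (Vf n).contDiff.contDiffOn S.sH hf hp, S.fH hp]
  congr 2
  simp [Hf, L]

lemma cVHn {f : T n → M} (hf : ContDiffOn ℝ ∞ f (OO n U)) (h : NoV f) {p : T n}
    (hp : p ∈ OO n U) :
    L (Vf n) (L (Hf G) f) p = L (Hf G) (L (Vf n) f) p := by
  rw [S.cVH hf hp, h.fderiv_eq S.op hf hp, add_zero]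

lemma VRv {p : T n} (hp : p ∈ OO n U) : L (Vf n) (Rv G) p =
    L (Hf G) (L (Vf n) G) p - L (Df G) (L (Vf n) (L (Vf n) G)) p := by
  have h1 := (diffAt S.op (S.sLH G S.hG) hp).hasFDerivAt
  have h2 := (diffAt S.op (S.sLD _ (S.sV G S.hG)) hp).hasFDerivAt
  have h3 : fderiv ℝ (Rv G) p = _ := ((h1.const_smul (2 : ℝ)).sub h2).fderiv
  have h4 : L (Vf n) (Rv G) p = (2 : ℝ) • L (Vf n) (L (Hf G) G) p
      - L (Vf n) (L (Df G) (L (Vf n) G)) p := by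
    unfold L at *
    rw [h3]; rfl
  have h5 := S.cDV (S.sV G S.hG) hp
  rw [h4, S.cVHn S.hG S.nG hp, h5]
  module

lemma cDH {f : T n → M} (hf : ContDiffOn ℝ ∞ f (OO n U)) {p : T n} (hp : p ∈ OO n U) :
    L (Df G) (L (Hf G) f) p = L (Hf G) (L (Df G) f) p +
      fderiv ℝ f p (0, Rv G p, L (Vf n) (Rv G) p) := by
  rw [L_comm S.op S.sD S.sH hf hp, S.fH hp, S.fD hp, S.VRv hp]
  congr 2
  simp only [Prod.mk_sub_mk]
  refine Prod.ext ?_ (Prod.ext ?_ ?_)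
  · simp [Df, Hf]
  · simp only [Rv, L]
    module
  · simp only [L]
    module

end Setup
end Core

section Core2
open scoped ContDiff Topology
variable {n : ℕ} {M : Type*} [NormedAddCommGroup M] [NormedSpace ℝ M]

/-- `[F²]_{y^i y^j} v^i v^j`. -/
def g2 (Q : T n → ℝ) : T n → ℝ := L (Vf n) (L (Vf n) Q)
/-- `[F²]_{y^i y^j y^k} v^i v^j v^k`. -/
def C3 (Q : T n → ℝ) : T n → ℝ := L (Vf n) (g2 Q)
/-- Four times `F² h(v,v)`. -/
def A4 (Q : T n → ℝ) : T n → ℝ := fun p => 2 * Q p * g2 Q p - (L (Vf n) Q p) ^ 2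
/-- Four times `R(v,v)`. -/
def r4 (Q : T n → ℝ) (G : T n → E n) : T n → ℝ := fun p => fderiv ℝ (g2 Q) p (0, 0, Rv G p)

namespace Setup
variable {U : Set (E n)} {Q : T n → ℝ} {G : T n → E n}

lemma sg2 (S : Setup U Q G) : ContDiffOn ℝ ∞ (g2 Q) (OO n U) := S.sV _ (S.sV _ S.hQ)
lemma sC3 (S : Setup U Q G) : ContDiffOn ℝ ∞ (C3 Q) (OO n U) := S.sV _ S.sg2
lemma sA4 (S : Setup U Q G) : ContDiffOn ℝ ∞ (A4 Q) (OO n U) := by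
  have h1 := S.sg2
  have h2 := S.sV _ S.hQ
  have h3 := S.hQ
  unfold A4
  fun_prop
lemma sZ (S : Setup U Q G) :
    ContDiffOn ℝ ∞ (fun p : T n => ((0, 0, Rv G p) : T n)) (OO n U) := by
  have := S.sRv
  fun_prop
lemma sr4 (S : Setup U Q G) : ContDiffOn ℝ ∞ (r4 Q G) (OO n U) := L_smooth S.op S.sZ S.sg2

lemma eulerD (S : Setup U Q G) {p : T n} (hp : p ∈ OO n U) : L (Yf n) (L (Vf n) Q) p = L (Vf n) Q p := by
  have h1 := L_comm S.op (Yf n).contDiff.contDiffOn (Vf n).contDiff.contDiffOn S.hQ hp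
  have h2 : L (Vf n) (L (Yf n) Q) p = 2 * L (Vf n) Q p := by
    change fderiv ℝ _ p _ = _
    rw [L_congr S.op (g := fun p => 2 * Q p) S.euler hp]
    have := ((diffAt S.op S.hQ hp).hasFDerivAt.const_mul 2).fderiv
    rw [this]; rfl
  rw [h1, h2]
  have : fderiv ℝ (Vf n) p (Yf n p) - fderiv ℝ (Yf n) p (Vf n p) = - Vf n p := by simp
  rw [this, map_neg]
  change 2 * L (Vf n) Q p - L (Vf n) Q p = _
  ring

lemma eulerG (S : Setup U Q G) {p : T n} (hp : p ∈ OO n U) : fderiv ℝ (g2 Q) p (0, p.2.1, 0) = 0 := by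
  have h1 := L_comm S.op (Yf n).contDiff.contDiffOn (Vf n).contDiff.contDiffOn (S.sV _ S.hQ) hp
  have h2 : L (Vf n) (L (Yf n) (L (Vf n) Q)) p = g2 Q p := by
    change fderiv ℝ _ p _ = _
    rw [L_congr S.op (g := L (Vf n) Q) (fun q hq => S.eulerD hq) hp]
    rfl
  have h3 : fderiv ℝ (Vf n) p (Yf n p) - fderiv ℝ (Yf n) p (Vf n p) = - Vf n p := by simp
  rw [h2, h3, map_neg] at h1
  change fderiv ℝ (g2 Q) p (0, p.2.1, 0) = g2 Q p - g2 Q p at h1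
  rw [h1, sub_self]

/-- Derivative in a `v` direction versus `y` direction. -/
lemma cZV (S : Setup U Q G) {f : T n → ℝ} (hf : ContDiffOn ℝ ∞ f (OO n U)) {p : T n} (hp : p ∈ OO n U)
    (w : E n) : fderiv ℝ (L (Vf n) f) p (0, 0, w) =
      fderiv ℝ f p (0, w, 0) + L (Vf n) (L (fun _ => (0, 0, w)) f) p := by
  have := L_comm S.op (X := fun _ => ((0, 0, w) : T n)) contDiffOn_const
    (Vf n).contDiff.contDiffOn hf hp
  change L (fun _ => ((0, 0, w) : T n)) (L (Vf n) f) p = _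
  rw [this, add_comm]
  simp

lemma cWV (S : Setup U Q G) {f : T n → ℝ} (hf : ContDiffOn ℝ ∞ f (OO n U)) {p : T n} (hp : p ∈ OO n U)
    (w : E n) : L (fun _ => (0, w, 0)) (L (Vf n) f) p = L (Vf n) (L (fun _ => (0, w, 0)) f) p := by
  have := L_comm S.op (X := fun _ => ((0, w, 0) : T n)) contDiffOn_const
    (Vf n).contDiff.contDiffOn hf hp
  rw [this]
  simp
  exact (fderiv ℝ f p).map_zero

lemma sW (S : Setup U Q G) {f : T n → ℝ} (hf : ContDiffOn ℝ ∞ f (OO n U)) (w : T n) :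
    ContDiffOn ℝ ∞ (L (fun _ => w) f) (OO n U) := L_smooth S.op contDiffOn_const hf

lemma ZVQ (S : Setup U Q G) {p : T n} (hp : p ∈ OO n U) (w : E n) :
    fderiv ℝ (L (Vf n) Q) p (0, 0, w) = fderiv ℝ Q p (0, w, 0) := by
  rw [S.cZV S.hQ hp]
  have : L (Vf n) (L (fun _ => (0, 0, w)) Q) p = 0 :=
    L_zero S.op (fun q hq => S.nQ.fderiv_eq S.op S.hQ hq w) hp _
  rw [this, add_zero]

lemma Zg2 (S : Setup U Q G) {p : T n} (hp : p ∈ OO n U) (w : E n) :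
    fderiv ℝ (g2 Q) p (0, 0, w) = 2 * fderiv ℝ (L (Vf n) Q) p (0, w, 0) := by
  rw [show g2 Q = L (Vf n) (L (Vf n) Q) from rfl, S.cZV (S.sV _ S.hQ) hp]
  have : L (Vf n) (L (fun _ => (0, 0, w)) (L (Vf n) Q)) p = L (Vf n) (L (fun _ => (0, w, 0)) Q) p :=
    L_congr S.op (fun q hq => S.ZVQ hq w) hp _
  rw [this, ← S.cWV S.hQ hp]
  change _ + fderiv ℝ (L (Vf n) Q) p (0, w, 0) = _
  ring

lemma ZC3 (S : Setup U Q G) {p : T n} (hp : p ∈ OO n U) (w : E n) :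
    fderiv ℝ (C3 Q) p (0, 0, w) = 3 * fderiv ℝ (g2 Q) p (0, w, 0) := by
  rw [show C3 Q = L (Vf n) (g2 Q) from rfl, S.cZV S.sg2 hp]
  have h1 : L (Vf n) (L (fun _ => (0, 0, w)) (g2 Q)) p =
      2 * L (Vf n) (L (fun _ => (0, w, 0)) (L (Vf n) Q)) p := by
    change fderiv ℝ _ p _ = _
    rw [L_congr S.op (f := L (fun _ => (0, 0, w)) (g2 Q))
      (g := fun q => 2 * L (fun _ => (0, w, 0)) (L (Vf n) Q) q)
      (fun q hq => S.Zg2 hq w) hp]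
    have := ((diffAt S.op (S.sW (S.sV _ S.hQ) (0, w, 0)) hp).hasFDerivAt.const_mul 2).fderiv
    rw [this]; rfl
  rw [h1, ← S.cWV (S.sV _ S.hQ) hp]
  change _ + 2 * fderiv ℝ (g2 Q) p (0, w, 0) = _
  ring

lemma DQ (S : Setup U Q G) {p : T n} (hp : p ∈ OO n U) : L (Df G) Q p = 0 := by
  -- evaluate at `v = y`
  have hp' : ((p.1, p.2.1, p.2.1) : T n) ∈ OO n U := hp
  set p' : T n := (p.1, p.2.1, p.2.1) with hp'd
  have e1 : ∀ q ∈ OO n U, ∀ a b : E n, fderiv ℝ Q q (a, b, 0) = fderiv ℝ Q (q.1, q.2.1, 0) (a, b, 0) := by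
    intro q hq a b
    have hc : Q = Q ∘ fun z : T n => z + ((0, 0, - q.2.2) : T n) := by
      funext z
      rw [Function.comp, S.nQ z, S.nQ (z + _)]; simp
    conv_lhs => rw [hc]
    have hq0 : q + ((0, 0, - q.2.2) : T n) = (q.1, q.2.1, 0) := by
      refine Prod.ext ?_ (Prod.ext ?_ ?_) <;> simp
    have h0 := fderiv_comp_add_right (𝕜 := ℝ) (f := Q) (x := q) ((0, 0, - q.2.2) : T n)
    change fderiv ℝ (fun z => Q (z + ((0, 0, - q.2.2) : T n))) q (a, b, 0) = _
    rw [h0, hq0]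
  have hel := S.el p' hp'
  -- differentiate `L Y Q = 2 Q` in the direction `(y, -2G, 0)`
  have h1 : fderiv ℝ (L (Yf n) Q) p' (p.2.1, (-2 : ℝ) • G p, 0) =
      2 * fderiv ℝ Q p' (p.2.1, (-2 : ℝ) • G p, 0) := by
    rw [L_congr S.op (g := fun q => 2 * Q q) S.euler hp']
    have := ((diffAt S.op S.hQ hp').hasFDerivAt.const_mul 2).fderiv
    rw [this]; rfl
  have hdf : DifferentiableAt ℝ (fderiv ℝ Q) p' :=
    ((S.hQ.fderiv_of_isOpen S.op (m := ∞) (by simp)).contDiffAt (S.op.mem_nhds hp')).differentiableAt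
      (by simp)
  have key : ∀ (Z : T n →L[ℝ] T n) (w : T n),
      fderiv ℝ (L Z Q) p' w = fderiv ℝ (fderiv ℝ Q) p' w (Z p') + fderiv ℝ Q p' (Z w) := by
    intro Z w
    have : fderiv ℝ (L Z Q) p' = _ := fderiv_clm_apply hdf Z.differentiableAt
    rw [this]
    simp [add_comm]
  have hG : G p' = G p := by rw [S.nG p, S.nG p']
  rw [key] at h1
  rw [key, hG] at hel
  have hV : Vf n p' = Yf n p' := rfl
  rw [hV] at hel
  simp only [Vf_apply, Yf_apply] at h1 hel
  have h00 : fderiv ℝ Q p' ((0, 0, 0) : T n) = 0 := (fderiv ℝ Q p').map_zero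
  rw [h00] at hel
  have h5 : fderiv ℝ Q p' (p.2.1, (-2 : ℝ) • G p, 0) =
    fderiv ℝ Q p' (p.2.1, 0, 0) + fderiv ℝ Q p' (0, (-2 : ℝ) • G p, 0) := by
    rw [← map_add]; simp
  have h6 : fderiv ℝ Q p' (p.2.1, (-2 : ℝ) • G p, 0) = 0 := by
    have hz : p'.2.2 = p.2.1 := rfl
    rw [hz] at hel
    linarith
  have h7 : L (Df G) Q p = fderiv ℝ Q p (p.2.1, (-2 : ℝ) • G p, 0) +
      fderiv ℝ Q p (0, 0, - L (Vf n) G p) := by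
    rw [← map_add]; simp [L, Df]
  rw [h7, S.nQ.fderiv_eq S.op S.hQ hp, add_zero, e1 p hp, ← h6, e1 p' hp']

lemma DVQ_HQ (S : Setup U Q G) {p : T n} (hp : p ∈ OO n U) : L (Df G) (L (Vf n) Q) p = L (Hf G) Q p := by
  have h1 : L (Df G) (L (Vf n) Q) p = fderiv ℝ (L (Vf n) Q) p (p.2.1, (-2 : ℝ) • G p, 0) +
      fderiv ℝ (L (Vf n) Q) p (0, 0, - L (Vf n) G p) := by
    rw [← map_add]; simp [L, Df]
  have h2 : L (Hf G) Q p = fderiv ℝ Q p (p.2.2, 0, 0) + fderiv ℝ Q p (0, - L (Vf n) G p, 0)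
     + fderiv ℝ Q p (0, 0, - L (Vf n) (L (Vf n) G) p) := by
    rw [← map_add, ← map_add]; simp [L, Hf]
  rw [h1, h2, S.el p hp, S.ZVQ hp, S.nQ.fderiv_eq S.op S.hQ hp, add_zero]

lemma HQ (S : Setup U Q G) {p : T n} (hp : p ∈ OO n U) : L (Hf G) Q p = 0 := by
  have h1 := S.cDV S.hQ hp
  have h2 : L (Vf n) (L (Df G) Q) p = 0 := L_zero S.op (fun q hq => S.DQ hq) hp _
  rw [S.DVQ_HQ hp, h2] at h1
  linarith

lemma DVQ (S : Setup U Q G) {p : T n} (hp : p ∈ OO n U) : L (Df G) (L (Vf n) Q) p = 0 := by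
  rw [S.DVQ_HQ hp, S.HQ hp]

lemma Dg2 (S : Setup U Q G) {p : T n} (hp : p ∈ OO n U) : L (Df G) (g2 Q) p = 0 := by
  have h1 := S.cDV (S.sV _ S.hQ) hp
  have h2 : L (Vf n) (L (Df G) (L (Vf n) Q)) p = 0 := L_zero S.op (fun q hq => S.DVQ hq) hp _
  have h3 := S.cVHn S.hQ S.nQ hp
  have h4 : L (Vf n) (L (Hf G) Q) p = 0 := L_zero S.op (fun q hq => S.HQ hq) hp _
  rw [h2, ← h3, h4, sub_zero] at h1
  exact h1

lemma DC3 (S : Setup U Q G) {p : T n} (hp : p ∈ OO n U) : L (Df G) (C3 Q) p = - L (Hf G) (g2 Q) p := by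
  have h1 := S.cDV S.sg2 hp
  have h2 : L (Vf n) (L (Df G) (g2 Q)) p = 0 := L_zero S.op (fun q hq => S.Dg2 hq) hp _
  rw [h2, zero_sub] at h1
  exact h1

lemma DA4 (S : Setup U Q G) {p : T n} (hp : p ∈ OO n U) : L (Df G) (A4 Q) p = 0 := by
  have hq := (diffAt S.op S.hQ hp).hasFDerivAt
  have hg := (diffAt S.op S.sg2 hp).hasFDerivAt
  have hv := (diffAt S.op (S.sV _ S.hQ) hp).hasFDerivAt
  have h : fderiv ℝ (A4 Q) p = _ := (((hq.const_mul 2).mul hg).sub (hv.pow 2)).fderiv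
  have h1 := S.DQ hp
  have h2 := S.Dg2 hp
  have h3 := S.DVQ hp
  unfold L at h1 h2 h3 ⊢
  rw [h]
  simp only [_root_.sub_apply, _root_.add_apply,
    _root_.smul_apply, smul_eq_mul]
  unfold L
  rw [h1, h2, h3]; simp

lemma VA4 (S : Setup U Q G) {p : T n} (hp : p ∈ OO n U) : L (Vf n) (A4 Q) p = 2 * Q p * C3 Q p := by
  have hq := (diffAt S.op S.hQ hp).hasFDerivAt
  have hg := (diffAt S.op S.sg2 hp).hasFDerivAt
  have hv := (diffAt S.op (S.sV _ S.hQ) hp).hasFDerivAt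
  have h : fderiv ℝ (A4 Q) p = _ := (((hq.const_mul 2).mul hg).sub (hv.pow 2)).fderiv
  change fderiv ℝ (A4 Q) p (Vf n p) = _
  rw [h]
  simp only [_root_.sub_apply, _root_.add_apply,
    _root_.smul_apply, smul_eq_mul]
  change 2 * Q p * C3 Q p + g2 Q p * (2 * L (Vf n) Q p) - _ * g2 Q p = _
  simp; ring

lemma ZA4 (S : Setup U Q G) {p : T n} (hp : p ∈ OO n U) (w : E n) : fderiv ℝ (A4 Q) p (0, 0, w) =
    2 * Q p * fderiv ℝ (g2 Q) p (0, 0, w) - 2 * L (Vf n) Q p * fderiv ℝ Q p (0, w, 0) := by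
  have hq := (diffAt S.op S.hQ hp).hasFDerivAt
  have hg := (diffAt S.op S.sg2 hp).hasFDerivAt
  have hv := (diffAt S.op (S.sV _ S.hQ) hp).hasFDerivAt
  have h : fderiv ℝ (A4 Q) p = _ := (((hq.const_mul 2).mul hg).sub (hv.pow 2)).fderiv
  rw [h]
  simp only [_root_.sub_apply, _root_.add_apply,
    _root_.smul_apply, smul_eq_mul]
  rw [S.ZVQ hp, S.nQ.fderiv_eq S.op S.hQ hp]
  simp

/-- The key identity. -/
lemma DDC3 (S : Setup U Q G) {p : T n} (hp : p ∈ OO n U) : L (Df G) (L (Df G) (C3 Q)) p =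
    fderiv ℝ (g2 Q) p (0, Rv G p, 0) - L (Vf n) (r4 Q G) p := by
  have h1 : L (Df G) (L (Df G) (C3 Q)) p = - L (Df G) (L (Hf G) (g2 Q)) p := by
    change fderiv ℝ _ p _ = _
    rw [L_congr S.op (g := fun q => - L (Hf G) (g2 Q) q) (fun q hq => S.DC3 hq) hp]
    have := (diffAt S.op (S.sLH _ S.sg2) hp).hasFDerivAt.neg.fderiv
    change fderiv ℝ (- L (Hf G) (g2 Q)) p _ = _
    rw [this]; rfl
  have h2 := S.cDH S.sg2 hp
  have h3 : L (Hf G) (L (Df G) (g2 Q)) p = 0 := L_zero S.op (fun q hq => S.Dg2 hq) hp _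
  have h4 := L_comm S.op (Vf n).contDiff.contDiffOn S.sZ S.sg2 hp
  have h5 : fderiv ℝ (fun p : T n => ((0, 0, Rv G p) : T n)) p (Vf n p) = (0, 0, L (Vf n) (Rv G) p) := by
    have hr := (diffAt S.op S.sRv hp).hasFDerivAt
    have := ((hasFDerivAt_const (0 : E n) p).prodMk ((hasFDerivAt_const (0 : E n) p).prodMk hr)).fderiv
    rw [this]; rfl
  rw [h5] at h4
  have h6 : L (fun p : T n => ((0, 0, Rv G p) : T n)) (L (Vf n) (g2 Q)) p =
    3 * fderiv ℝ (g2 Q) p (0, Rv G p, 0) := S.ZC3 hp (Rv G p)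
  have h7 : fderiv ℝ (g2 Q) p ((0, 0, L (Vf n) (Rv G) p) -
      fderiv ℝ (Vf n) p ((0, 0, Rv G p) : T n)) = fderiv ℝ (g2 Q) p (0, 0, L (Vf n) (Rv G) p)
      - fderiv ℝ (g2 Q) p (0, Rv G p, 0) := by
    rw [map_sub]; simp
  have h8 : fderiv ℝ (g2 Q) p (0, Rv G p, L (Vf n) (Rv G) p) =
     fderiv ℝ (g2 Q) p (0, Rv G p, 0) + fderiv ℝ (g2 Q) p (0, 0, L (Vf n) (Rv G) p) := by
    rw [← map_add]; simp
  rw [h6, h7] at h4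
  change L (Vf n) (r4 Q G) p = _ at h4
  rw [h1, h2, h3, h8, h4]
  ring

end Setup
end Core2

section Alg
variable {W : Type*} [AddCommGroup W] [Module ℝ W]

/-- Comparing coefficients. -/
lemma coeff_compare {q α c0 c1 c2 c3 t0 t1 t2 t3 : ℝ} (hq : q ≠ 0)
    (h : ∀ s : ℝ, (s ^ 2 + α) * (t0 + t1 * s + t2 * s ^ 2 + t3 * s ^ 3) =
      q * (c0 + c1 * s + c2 * s ^ 2 + c3 * s ^ 3)) :
    c1 = α * c3 ∧ c0 = α * c2 := by
  have h0 := h 0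
  have h1 := h 1
  have h2 := h (-1)
  have h3 := h 2
  have h4 := h (-2)
  have h5 := h 3
  have h6 := h (-3)
  ring_nf at h0 h1 h2 h3 h4 h5 h6
  have e3 : t3 = 0 := by linarith
  have e2 : t2 = 0 := by linarith
  subst e3 e2
  ring_nf at h1 h2 h3 h4 h5 h6
  constructor
  · apply mul_left_cancel₀ hq
    have a1 : t1 = q * c3 := by linarith
    have a2 : q * c1 = α * t1 := by linarith
    rw [a2, a1]; ring
  · apply mul_left_cancel₀ hq
    have a1 : t0 = q * c2 := by linarith
    have a2 : q * c0 = α * t0 := by linarith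
    rw [a2, a1]; ring

/-- A cubic function vanishing where a nonzero quadratic does not vanish is zero. -/
lemma cubic_zero {q0 q1 q2 f0 f1 f2 f3 : ℝ} (hq : q2 ≠ 0)
    (h : ∀ s : ℝ, q0 + q1 * s + q2 * s ^ 2 ≠ 0 → f0 + f1 * s + f2 * s ^ 2 + f3 * s ^ 3 = 0) :
    f0 = 0 := by
  have hp : ∀ s : ℝ, (q0 + q1 * s + q2 * s ^ 2) * (f0 + f1 * s + f2 * s ^ 2 + f3 * s ^ 3) = 0 := by
    intro s
    by_cases hs : q0 + q1 * s + q2 * s ^ 2 = 0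
    · rw [hs, zero_mul]
    · rw [h s hs, mul_zero]
  have h0 := hp 0
  have h1 := hp 1
  have h2 := hp (-1)
  have h3 := hp 2
  have h4 := hp (-2)
  have h5 := hp 3
  have h6 := hp (-3)
  ring_nf at h0 h1 h2 h3 h4 h5 h6
  have e5 : q2 * f3 = 0 := by linarith
  have f3z : f3 = 0 := by simpa [hq] using e5
  subst f3z
  have e4 : q2 * f2 = 0 := by linarith
  have f2z : f2 = 0 := by simpa [hq] using e4
  subst f2z
  have e3 : q2 * f1 = 0 := by linarith
  have f1z : f1 = 0 := by simpa [hq] using e3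
  subst f1z
  have e3 : q2 * f0 = 0 := by linarith
  simpa [hq] using e3

/-- Divisibility of a cubic form by the quadratic form `a`. -/
lemma div_cubic (a ρ : W →ₗ[ℝ] W →ₗ[ℝ] ℝ) (hs : ∀ u v, a u v = a v u) (hρ : ∀ u v, ρ u v = ρ v u)
    (c : W →ₗ[ℝ] W →ₗ[ℝ] W →ₗ[ℝ] ℝ) (Tf : W → ℝ)
    (hT : ∀ u w, ∃ t0 t1 t2 t3 : ℝ, ∀ s : ℝ,
      Tf (s • u + w) = t0 + t1 * s + t2 * s ^ 2 + t3 * s ^ 3)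
    (e1 : W) (l : ℝ) (he : a e1 e1 = 1) (hl : ∀ v, ρ e1 v = l * a e1 v)
    (v0 : W) (hv0 : ρ v0 v0 - l * a v0 v0 ≠ 0)
    (h : ∀ v, ρ v v - l * a v v ≠ 0 → a v v * Tf v = ρ v v * c v v v) :
    ∃ I : W →ₗ[ℝ] ℝ, ∀ v, c v v v = a v v * I v := by
  let c2 : W →ₗ[ℝ] ℝ := c e1 e1 + (c e1).flip e1 + (c.flip e1).flip e1
  have hc2 : ∀ w, c2 w = c e1 e1 w + c e1 w e1 + c w e1 e1 := fun w => rfl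
  let I : W →ₗ[ℝ] ℝ := c2 + (c e1 e1 e1 - c2 e1) • a e1
  have hI : ∀ w, I w = c2 w + (c e1 e1 e1 - c2 e1) * a e1 w := fun w => rfl
  -- generic case
  have gen : ∀ v, ρ v v - l * a v v ≠ 0 → c v v v = a v v * I v := by
    intro v hv
    obtain ⟨w, σ, hw, hvw⟩ : ∃ (w : W) (σ : ℝ), a e1 w = 0 ∧ v = σ • e1 + w := by
      refine ⟨v - (a e1 v) • e1, a e1 v, ?_, by abel⟩
      simp [he]
    have hw' : a w e1 = 0 := by rw [hs, hw]
    have hq : ∀ s : ℝ, ρ (s • e1 + w) (s • e1 + w) - l * a (s • e1 + w) (s • e1 + w) =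
        ρ w w - l * a w w := by
      intro s
      simp only [map_add, map_smul, LinearMap.add_apply, LinearMap.smul_apply, smul_eq_mul,
        hρ w e1, hl, he, hw, hw']
      ring
    have ha : ∀ s : ℝ, a (s • e1 + w) (s • e1 + w) = s ^ 2 + a w w := by
      intro s
      simp only [map_add, map_smul, LinearMap.add_apply, LinearMap.smul_apply, smul_eq_mul,
        he, hw, hw']
      ring
    have hqw : ρ w w - l * a w w ≠ 0 := by rw [← hq σ, ← hvw]; exact hv
    obtain ⟨t0, t1, t2, t3, ht⟩ := hT e1 w
    have hc : ∀ s : ℝ, c (s • e1 + w) (s • e1 + w) (s • e1 + w) =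
        c w w w + (c e1 w w + c w e1 w + c w w e1) * s + c2 w * s ^ 2 + c e1 e1 e1 * s ^ 3 := by
      intro s
      simp only [map_add, map_smul, LinearMap.add_apply, LinearMap.smul_apply, smul_eq_mul, hc2]
      ring
    have key := coeff_compare (q := ρ w w - l * a w w) (α := a w w)
      (c0 := c w w w) (c1 := c e1 w w + c w e1 w + c w w e1) (c2 := c2 w) (c3 := c e1 e1 e1)
      (t0 := t0 - l * c w w w) (t1 := t1 - l * (c e1 w w + c w e1 w + c w w e1))
      (t2 := t2 - l * c2 w) (t3 := t3 - l * c e1 e1 e1) hqw (by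
        intro s
        have h1 := h (s • e1 + w) (by rw [hq]; exact hqw)
        have h2 := hq s
        rw [ht, hc, ha] at h1
        rw [ha] at h2
        have h3 : ρ (s • e1 + w) (s • e1 + w) = ρ w w - l * a w w + l * (s ^ 2 + a w w) := by
          linarith
        rw [h3] at h1
        linear_combination h1)
    obtain ⟨k1, k0⟩ := key
    rw [hvw, hc, ha, hI, k1, k0]
    simp only [map_add, map_smul, smul_eq_mul, he, hw]
    ring
  refine ⟨I, fun v => ?_⟩
  have hz := cubic_zero (q0 := ρ v v - l * a v v)
    (q1 := ρ v v0 + ρ v0 v - l * (a v v0 + a v0 v)) (q2 := ρ v0 v0 - l * a v0 v0)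
    (f0 := c v v v - a v v * I v)
    (f1 := c v0 v v + c v v0 v + c v v v0 - (a v v0 + a v0 v) * I v - a v v * I v0)
    (f2 := c v0 v0 v + c v0 v v0 + c v v0 v0 - a v0 v0 * I v - (a v v0 + a v0 v) * I v0)
    (f3 := c v0 v0 v0 - a v0 v0 * I v0) hv0 (by
      intro s hs1
      have h1 := gen (v + s • v0) (by
        intro h0; apply hs1; rw [← h0]
        simp only [map_add, map_smul, LinearMap.add_apply, LinearMap.smul_apply, smul_eq_mul]
        ring)
      simp only [map_add, map_smul, LinearMap.add_apply, LinearMap.smul_apply, smul_eq_mul] at h1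
      linear_combination h1)
  linarith

/-- Divisibility of a product of a quadratic and a linear form. -/
lemma div_lin (a ρ : W →ₗ[ℝ] W →ₗ[ℝ] ℝ) (ℓ I : W →ₗ[ℝ] ℝ) (m : W → ℝ)
    (hm : ∀ (s t : ℝ) (u v : W), m (s • u + t • v) = s * m u + t * m v)
    (ha : ∀ v, ℓ v = 0 → a v v = 0 → v = 0)
    (h : ∀ v, ℓ v = 0 → ρ v v * I v = a v v * m v) (u : W) (hu : ℓ u = 0) (hI : I u ≠ 0) :
    ∃ k : ℝ, ∀ v, ℓ v = 0 → ρ v v = k * a v v := by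
  have hm0 : m 0 = 0 := by simpa using hm 0 0 0 0
  have hmI : ∀ v, ℓ v = 0 → I u * m v = I v * m u := by
    intro v hv
    have h1 : ℓ (I u • v + (-I v) • u) = 0 := by simp [hu, hv]
    have h2 := h _ h1
    have h3 : I (I u • v + (-I v) • u) = 0 := by simp; ring
    rw [h3, mul_zero] at h2
    have h4 : m (I u • v + (-I v) • u) = 0 := by
      rcases mul_eq_zero.1 h2.symm with h5 | h5
      · rw [ha _ h1 h5, hm0]
      · exact h5
    rw [hm] at h4
    linarith
  refine ⟨m u / I u, ?_⟩
  have gen : ∀ v, ℓ v = 0 → I v ≠ 0 → ρ v v = m u / I u * a v v := by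
    intro v hv hIv
    have h1 := h v hv
    have h2 := hmI v hv
    field_simp
    apply mul_left_cancel₀ hIv
    linear_combination I u * h1 + a v v * h2
  intro v hv
  by_cases hIv : I v = 0
  · have hh : ∀ s : ℝ, s ≠ 0 → ρ (v + s • u) (v + s • u) = m u / I u * a (v + s • u) (v + s • u) := by
      intro s hs
      exact gen _ (by simp [hu, hv]) (by simp [hIv, hs, hI])
    have g1 := hh 1 one_ne_zero
    have g2 := hh (-1) (by norm_num)
    have g3 := hh 2 (by norm_num)
    simp only [map_add, map_smul, LinearMap.add_apply, LinearMap.smul_apply, smul_eq_mul] at g1 g2 g3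
    linear_combination g1 + (1/3) * g2 - (1/3) * g3
  · exact gen v hv hIv

end Alg

/-- Existence of an eigenvector. -/
lemma exists_eigen {n : ℕ} (hn : 2 ≤ n) (a ρ : E n →ₗ[ℝ] E n →ₗ[ℝ] ℝ)
    (hs : ∀ u v, a u v = a v u) (hρ : ∀ u v, ρ u v = ρ v u)
    (y : E n) (ℓ : E n →ₗ[ℝ] ℝ) (hy : ℓ y ≠ 0)
    (ha : ∀ v, ℓ v = 0 → v ≠ 0 → 0 < a v v) (hay : ∀ v, a y v = 0) (hry : ∀ v, ρ y v = 0) :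
    ∃ (e1 : E n) (l : ℝ), a e1 e1 = 1 ∧ ∀ v, ρ e1 v = l * a e1 v := by
  have cont : ∀ b : E n →ₗ[ℝ] E n →ₗ[ℝ] ℝ, Continuous fun v => b v v := by
    intro b
    have : (fun v => b v v) = fun v : E n => ∑ i, ∑ j, v i * v j * b (Pi.single i 1) (Pi.single j 1) := by
      funext v
      conv_lhs => rw [pi_eq_sum_univ' v]
      simp only [map_sum, map_smul, LinearMap.sum_apply, LinearMap.smul_apply, smul_eq_mul,
        Finset.mul_sum]
      rw [Finset.sum_comm]
      refine Finset.sum_congr rfl fun i _ => Finset.sum_congr rfl fun j _ => ?_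
      ring
    rw [this]; fun_prop
  have hℓ : Continuous ℓ := LinearMap.continuous_of_finiteDimensional ℓ
  have hker : ∃ u : E n, ℓ u = 0 ∧ u ≠ 0 := by
    have : LinearMap.ker ℓ ≠ ⊥ := by
      intro hb
      have h1 := LinearMap.finrank_le_finrank_of_injective (LinearMap.ker_eq_bot.1 hb)
      simp at h1; omega
    obtain ⟨u, hu, hu0⟩ := Submodule.exists_mem_ne_zero_of_ne_bot this
    exact ⟨u, hu, hu0⟩
  let K : Set (E n) := Metric.sphere 0 1 ∩ {v | ℓ v = 0}
  have hK : IsCompact K := (isCompact_sphere _ _).inter_right (isClosed_singleton.preimage hℓ)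
  have hKne : K.Nonempty := by
    obtain ⟨u, hu, hu0⟩ := hker
    refine ⟨‖u‖⁻¹ • u, ?_, ?_⟩
    · simp [norm_smul, hu0]
    · simp [hu]
  have hK0 : ∀ v ∈ K, v ≠ 0 := by
    rintro v ⟨hv, -⟩ rfl
    simp at hv
  have hc : ContinuousOn (fun v => ρ v v / a v v) K :=
    (cont ρ).continuousOn.div (cont a).continuousOn fun v hv => (ha v hv.2 (hK0 v hv)).ne'
  obtain ⟨e0, he0, hmax⟩ := hK.exists_isMaxOn hKne hc
  have hpos := ha e0 he0.2 (hK0 e0 he0)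
  set l := ρ e0 e0 / a e0 e0 with hl
  have hle1 : ∀ v, ℓ v = 0 → ρ v v ≤ l * a v v := by
    intro v hv
    by_cases hv0 : v = 0
    · simp [hv0]
    have hmem : ‖v‖⁻¹ • v ∈ K := ⟨by simp [norm_smul, hv0], by simp [hv]⟩
    have h1 : ρ (‖v‖⁻¹ • v) (‖v‖⁻¹ • v) / a (‖v‖⁻¹ • v) (‖v‖⁻¹ • v) ≤ l := hmax hmem
    simp only [map_smul, LinearMap.smul_apply, smul_eq_mul] at h1
    have hnv : ‖v‖⁻¹ ≠ 0 := by simpa using hv0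
    rw [mul_div_mul_left _ _ hnv, mul_div_mul_left _ _ hnv, div_le_iff₀ (ha v hv hv0)] at h1
    exact h1
  have hle : ∀ v, ρ v v ≤ l * a v v := by
    intro v
    have h1 := hle1 (v - (ℓ v / ℓ y) • y) (by simp [hy])
    simp only [map_sub, map_smul, LinearMap.sub_apply, LinearMap.smul_apply, smul_eq_mul,
      hs v y, hρ v y, hay, hry] at h1
    linarith
  have h00 : ρ e0 e0 = l * a e0 e0 := by rw [hl]; field_simp
  have horth : ∀ v, ρ e0 v = l * a e0 v := by
    intro v
    set d := ρ e0 v - l * a e0 v with hd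
    have h1 : ∀ t : ℝ, 2 * t * d ≤ t ^ 2 * (l * a v v - ρ v v) := by
      intro t
      have := hle (e0 + t • v)
      simp only [map_add, map_smul, LinearMap.add_apply, LinearMap.smul_apply, smul_eq_mul,
        hs v e0, hρ v e0, h00] at this
      rw [hd]; linarith
    have h2 : 0 ≤ l * a v v - ρ v v := by linarith [hle v]
    have h3 := h1 (d / (l * a v v - ρ v v + 1))
    set m := l * a v v - ρ v v with hm
    have hm1 : 0 < m + 1 := by linarith
    have h4 : 2 * d ^ 2 * (m + 1) ≤ d ^ 2 * m := by
      have := mul_le_mul_of_nonneg_right h3 (sq_nonneg (m + 1))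
      have e1 : 2 * (d / (m + 1)) * d * (m + 1) ^ 2 = 2 * d ^ 2 * (m + 1) := by field_simp
      have e2 : (d / (m + 1)) ^ 2 * m * (m + 1) ^ 2 = d ^ 2 * m := by field_simp
      linarith
    have h5 : d ^ 2 = 0 := by nlinarith [sq_nonneg d]
    have h6 : d = 0 := by simpa using h5
    linarith
  refine ⟨(Real.sqrt (a e0 e0))⁻¹ • e0, l, ?_, ?_⟩
  · simp only [map_smul, LinearMap.smul_apply, smul_eq_mul]
    have := Real.mul_self_sqrt hpos.le
    have h2 : Real.sqrt (a e0 e0) ≠ 0 := (Real.sqrt_pos.2 hpos).ne'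
    field_simp
    nlinarith
  · intro v
    simp only [map_smul, LinearMap.smul_apply, smul_eq_mul, horth]
    ring

section Bridge
open scoped ContDiff Topology
variable {n : ℕ} {U : Set (E n)}

def lift (f : E n → E n → ℝ) : T n → ℝ := fun p => f p.1 p.2.1

def Sm (U : Set (E n)) (f : E n → E n → ℝ) : Prop := ContDiffOn ℝ ∞ (lift f) (OO n U)

lemma noV_lift (f : E n → E n → ℝ) : NoV (lift f) := fun _ => rfl

lemma pdx_eq (hU : IsOpen U) {f : E n → E n → ℝ} (hf : Sm U f) (k : Fin n) {p : T n}
    (hp : p ∈ OO n U) : pdx n f k p.1 p.2.1 = fderiv ℝ (lift f) p (e n k, 0, 0) := by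
  have h1 := (diffAt (isOpen_OO hU) hf hp).hasFDerivAt
  have h2 : HasFDerivAt (fun x' : E n => ((x', p.2.1, p.2.2) : T n))
      ((ContinuousLinearMap.id ℝ (E n)).prod ((0 : E n →L[ℝ] E n).prod (0 : E n →L[ℝ] E n))) p.1 :=
    (hasFDerivAt_id p.1).prodMk ((hasFDerivAt_const p.2.1 p.1).prodMk (hasFDerivAt_const p.2.2 p.1))
  have h3 := (HasFDerivAt.comp (g := lift f) (f := fun x' : E n => ((x', p.2.1, p.2.2) : T n)) p.1 h1 h2).fderiv
  change fderiv ℝ (lift f ∘ fun x' : E n => ((x', p.2.1, p.2.2) : T n)) p.1 (e n k) = _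
  rw [h3]; rfl

lemma fdy_eq (hU : IsOpen U) {f : T n → ℝ} (hf : ContDiffOn ℝ ∞ f (OO n U)) {p : T n}
    (hp : p ∈ OO n U) (w : E n) :
    fderiv ℝ (fun y' => f (p.1, y', p.2.2)) p.2.1 w = fderiv ℝ f p (0, w, 0) := by
  have h1 := (diffAt (isOpen_OO hU) hf hp).hasFDerivAt
  have h2 : HasFDerivAt (fun y' : E n => ((p.1, y', p.2.2) : T n))
      ((0 : E n →L[ℝ] E n).prod ((ContinuousLinearMap.id ℝ (E n)).prod (0 : E n →L[ℝ] E n))) p.2.1 :=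
    (hasFDerivAt_const p.1 p.2.1).prodMk ((hasFDerivAt_id p.2.1).prodMk (hasFDerivAt_const p.2.2 p.2.1))
  have h3 := (HasFDerivAt.comp (g := f) (f := fun y' : E n => ((p.1, y', p.2.2) : T n)) p.2.1 h1 h2).fderiv
  change fderiv ℝ (f ∘ fun y' : E n => ((p.1, y', p.2.2) : T n)) p.2.1 w = _
  rw [h3]; rfl

lemma pdy_eq (hU : IsOpen U) {f : E n → E n → ℝ} (hf : Sm U f) (k : Fin n) {p : T n}
    (hp : p ∈ OO n U) : pdy n f k p.1 p.2.1 = fderiv ℝ (lift f) p (0, e n k, 0) :=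
  fdy_eq hU hf hp (e n k)

lemma Sm.dx (hU : IsOpen U) {f : E n → E n → ℝ} (hf : Sm U f) (k : Fin n) : Sm U (pdx n f k) := by
  have h : ContDiffOn ℝ ∞ (L (fun _ => (e n k, 0, 0)) (lift f)) (OO n U) :=
    L_smooth (isOpen_OO hU) contDiffOn_const hf
  exact h.congr fun p hp => pdx_eq hU hf k hp

lemma Sm.dy (hU : IsOpen U) {f : E n → E n → ℝ} (hf : Sm U f) (k : Fin n) : Sm U (pdy n f k) := by
  have h : ContDiffOn ℝ ∞ (L (fun _ => (0, e n k, 0)) (lift f)) (OO n U) :=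
    L_smooth (isOpen_OO hU) contDiffOn_const hf
  exact h.congr fun p hp => pdy_eq hU hf k hp

lemma sum_e (a : E n) : a = ∑ k, a k • e n k := pi_eq_sum_univ' a

lemma fderiv_lift (hU : IsOpen U) {f : E n → E n → ℝ} (hf : Sm U f) {p : T n}
    (hp : p ∈ OO n U) (a b c : E n) : fderiv ℝ (lift f) p (a, b, c) =
      ∑ k, a k * pdx n f k p.1 p.2.1 + ∑ k, b k * pdy n f k p.1 p.2.1 := by
  have h1 : ((a, b, c) : T n) = ∑ k, a k • ((e n k, 0, 0) : T n) + ∑ k, b k • ((0, e n k, 0) : T n)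
      + (0, 0, c) := by
    refine Prod.ext ?_ (Prod.ext ?_ ?_)
    · simp [Prod.fst_sum, ← sum_e]
    · simp [Prod.fst_sum, Prod.snd_sum, ← sum_e]
    · simp [Prod.snd_sum]
  rw [h1, map_add, map_add, map_sum, map_sum, (noV_lift f).fderiv_eq (isOpen_OO hU) hf hp, add_zero]
  simp only [map_smul, smul_eq_mul, pdx_eq hU hf _ hp, pdy_eq hU hf _ hp]

lemma LV_lift (hU : IsOpen U) {f : E n → E n → ℝ} (hf : Sm U f) {p : T n}
    (hp : p ∈ OO n U) : L (Vf n) (lift f) p = ∑ k, p.2.2 k * pdy n f k p.1 p.2.1 := by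
  change fderiv ℝ (lift f) p (0, p.2.2, 0) = _
  rw [fderiv_lift hU hf hp]; simp

/-- Derivative of a function linear in `v`. -/
lemma fderiv_lin (hU : IsOpen U) {φ : Fin n → E n → E n → ℝ} (hφ : ∀ l, Sm U (φ l)) {p : T n}
    (hp : p ∈ OO n U) (a b c : E n) :
    fderiv ℝ (fun q : T n => ∑ l, q.2.2 l * lift (φ l) q) p (a, b, c) =
      ∑ l, (p.2.2 l * (∑ k, a k * pdx n (φ l) k p.1 p.2.1 + ∑ k, b k * pdy n (φ l) k p.1 p.2.1)
        + c l * φ l p.1 p.2.1) := by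
  have h0 : ∀ l, HasFDerivAt (fun q : T n => q.2.2 l)
      ((ContinuousLinearMap.proj l).comp ((ContinuousLinearMap.snd ℝ (E n) (E n)).comp
      (ContinuousLinearMap.snd ℝ (E n) (E n × E n))) : T n →L[ℝ] ℝ) p := fun l =>
    ((ContinuousLinearMap.proj (R := ℝ) (φ := fun _ : Fin n => ℝ) l).comp
      ((ContinuousLinearMap.snd ℝ (E n) (E n)).comp
      (ContinuousLinearMap.snd ℝ (E n) (E n × E n)))).hasFDerivAt
  have h1 : ∀ l ∈ Finset.univ, HasFDerivAt (fun q : T n => q.2.2 l * lift (φ l) q) _ p := fun l _ =>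
    (h0 l).mul (diffAt (isOpen_OO hU) (hφ l) hp).hasFDerivAt
  have h2 := (HasFDerivAt.fun_sum h1).fderiv
  rw [h2]
  simp only [_root_.sum_apply, _root_.add_apply, _root_.smul_apply, smul_eq_mul,
    fderiv_lift hU (hφ _) hp]
  refine Finset.sum_congr rfl fun l _ => ?_
  simp [lift, mul_comm]

/-- `L V` of a function quadratic in `v`. -/
lemma LV_quad (hU : IsOpen U) {φ : Fin n → Fin n → E n → E n → ℝ} (hφ : ∀ l m, Sm U (φ l m))
    {f : T n → ℝ} (hf : ContDiffOn ℝ ∞ f (OO n U))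
    (hfe : ∀ q ∈ OO n U, f q = ∑ l, ∑ m, q.2.2 l * q.2.2 m * φ l m q.1 q.2.1) {p : T n}
    (hp : p ∈ OO n U) :
    L (Vf n) f p = ∑ l, ∑ m, ∑ k, p.2.2 l * p.2.2 m * p.2.2 k * pdy n (φ l m) k p.1 p.2.1 := by
  change fderiv ℝ f p (0, p.2.2, 0) = _
  rw [← fdy_eq hU hf hp]
  have he : (fun y' => f (p.1, y', p.2.2)) =ᶠ[𝓝 p.2.1]
      fun y' => ∑ l, ∑ m, p.2.2 l * p.2.2 m * φ l m p.1 y' := by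
    filter_upwards [isOpen_ne.mem_nhds hp.2] with y' hy'
    exact hfe (p.1, y', p.2.2) ⟨hp.1, hy'⟩
  rw [he.fderiv_eq]
  have hd : ∀ l m, DifferentiableAt ℝ (fun y' => φ l m p.1 y') p.2.1 := by
    intro l m
    have h1 := (diffAt (isOpen_OO hU) (hφ l m) hp)
    exact DifferentiableAt.comp (g := lift (φ l m)) (f := fun y' : E n => ((p.1, y', p.2.2) : T n)) p.2.1 h1
      (by fun_prop)
  have h2 := (HasFDerivAt.fun_sum (u := Finset.univ) fun l _ => HasFDerivAt.fun_sum (u := Finset.univ) fun m _ =>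
    (hd l m).hasFDerivAt.const_mul (p.2.2 l * p.2.2 m)).fderiv
  rw [h2]
  simp only [_root_.sum_apply, _root_.smul_apply, smul_eq_mul]
  refine Finset.sum_congr rfl fun l _ => Finset.sum_congr rfl fun m _ => ?_
  have h3 : fderiv ℝ (fun y' => φ l m p.1 y') p.2.1 p.2.2 = ∑ k, p.2.2 k * pdy n (φ l m) k p.1 p.2.1 := by
    rw [← LV_lift hU (hφ l m) hp]
    exact fdy_eq hU (hφ l m) hp p.2.2
  rw [h3, Finset.mul_sum]
  exact Finset.sum_congr rfl fun k _ => by ring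

lemma Sm.mul {f g : E n → E n → ℝ} (hf : Sm U f) (hg : Sm U g) : Sm U (fun x y => f x y * g x y) :=
  ContDiffOn.mul hf hg
lemma Sm.add {f g : E n → E n → ℝ} (hf : Sm U f) (hg : Sm U g) : Sm U (fun x y => f x y + g x y) :=
  ContDiffOn.add hf hg
lemma Sm.sub {f g : E n → E n → ℝ} (hf : Sm U f) (hg : Sm U g) : Sm U (fun x y => f x y - g x y) :=
  ContDiffOn.sub hf hg
lemma Sm.const (c : ℝ) : Sm U (fun (_ _ : E n) => c) := contDiffOn_const
lemma Sm.coord (k : Fin n) : Sm U (fun (_ y : E n) => y k) := by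
  unfold Sm lift; fun_prop
lemma Sm.sum {ι : Type*} {s : Finset ι} {f : ι → E n → E n → ℝ} (hf : ∀ i, Sm U (f i)) :
    Sm U (fun x y => ∑ i ∈ s, f i x y) :=
  ContDiffOn.sum (f := fun i => lift (f i)) fun i _ => hf i
lemma Sm.prod {ι : Type*} {s : Finset ι} {f : ι → E n → E n → ℝ} (hf : ∀ i, Sm U (f i)) :
    Sm U (fun x y => ∏ i ∈ s, f i x y) :=
  contDiffOn_prod (f := fun i => lift (f i)) fun i _ => hf i

lemma Sm.det {m : ℕ} {A : E n → E n → Matrix (Fin m) (Fin m) ℝ}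
    (hA : ∀ i j, Sm U (fun x y => A x y i j)) : Sm U (fun x y => (A x y).det) := by
  simp only [Matrix.det_apply']
  exact Sm.sum fun σ => (Sm.const _).mul (Sm.prod fun i => hA _ _)

section Fins
variable {F : E n → E n → ℝ} (hU : IsOpen U) (hF : IsFinsler n U F)

lemma sm_F (hF : IsFinsler n U F) : Sm U F := by
  have h := hF.smooth
  refine ContDiffOn.comp (g := fun p : E n × E n => F p.1 p.2) (f := fun p : T n => (p.1, p.2.1)) h
    (by fun_prop) ?_
  intro p hp
  exact ⟨hp.1, hp.2⟩

lemma sm_F2 (hF : IsFinsler n U F) : Sm U (F2 n F) := by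
  have := (sm_F hF).mul (sm_F hF)
  have h2 : F2 n F = fun x y => F x y * F x y := by funext x y; simp [F2, sq]
  rw [h2]; exact this

include hU hF

lemma sm_gm (i j : Fin n) : Sm U (gm n F i j) :=
  (Sm.const _).mul (((sm_F2 hF).dy hU j).dy hU i)

lemma sm_ginv (i j : Fin n) : Sm U (fun x y => ginv n F x y i j) := by
  have hdet : Sm U (fun x y => (gmat n F x y).det) := Sm.det fun i j => sm_gm hU hF i j
  have hadj : Sm U (fun x y => (gmat n F x y).adjugate i j) := by
    simp only [Matrix.adjugate_apply]
    refine Sm.det fun k l => ?_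
    by_cases hk : k = j
    · subst hk
      simp only [Matrix.updateRow_self]
      exact Sm.const _
    · simp only [Matrix.updateRow_ne hk]
      exact sm_gm hU hF k l
  have hinv : Sm U (fun x y => ((gmat n F x y).det)⁻¹) := by
    refine ContDiffOn.inv (f := lift fun x y => (gmat n F x y).det) hdet ?_
    intro p hp
    exact (hF.posdef p.1 hp.1 p.2.1 hp.2).det_pos.ne'
  have : (fun x y => ginv n F x y i j) = fun x y => ((gmat n F x y).det)⁻¹ * (gmat n F x y).adjugate i j := by
    funext x y
    simp [ginv, Matrix.inv_def]
  rw [this]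
  exact hinv.mul hadj

lemma sm_spray (i : Fin n) : Sm U (Spray n F i) :=
  (Sm.const _).mul (Sm.sum fun l => (sm_ginv hU hF i l).mul
    ((Sm.sum fun k => (((sm_F2 hF).dy hU l).dx hU k).mul (Sm.coord k)).sub ((sm_F2 hF).dx hU l)))

lemma sm_riem (i k : Fin n) : Sm U (RiemUp n F i k) := by
  have hs := sm_spray hU hF
  exact ((((Sm.const _).mul ((hs i).dx hU k)).sub
    (Sm.sum fun j => (Sm.coord j).mul (((hs i).dy hU k).dx hU j))).add
    ((Sm.const _).mul (Sm.sum fun j => (hs j).mul (((hs i).dy hU k).dy hU j)))).sub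
    (Sm.sum fun j => ((hs i).dy hU j).mul ((hs j).dy hU k))

lemma sm_rlow (j k : Fin n) : Sm U (Rlow n F j k) :=
  Sm.sum fun i => (sm_gm hU hF i j).mul (sm_riem hU hF i k)

/-- The spray as a vector valued function. -/
def GG (n : ℕ) (F : E n → E n → ℝ) : T n → E n := fun p i => Spray n F i p.1 p.2.1

lemma sm_GG : ContDiffOn ℝ ∞ (GG n F) (OO n U) := contDiffOn_pi.2 fun i => sm_spray hU hF i

lemma LVQ {p : T n} (hp : p ∈ OO n U) : L (Vf n) (lift (F2 n F)) p =
    ∑ l, p.2.2 l * lift (pdy n (F2 n F) l) p := LV_lift hU (sm_F2 hF) hp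

lemma fderiv_LVQ {p : T n} (hp : p ∈ OO n U) (a b c : E n) :
    fderiv ℝ (L (Vf n) (lift (F2 n F))) p (a, b, c) =
    ∑ l, (p.2.2 l * (∑ k, a k * pdx n (pdy n (F2 n F) l) k p.1 p.2.1 +
      ∑ k, b k * pdy n (pdy n (F2 n F) l) k p.1 p.2.1) + c l * pdy n (F2 n F) l p.1 p.2.1) := by
  rw [L_congr (isOpen_OO hU) (fun q hq => LVQ hU hF hq) hp]
  exact fderiv_lin hU (fun l => (sm_F2 hF).dy hU l) hp a b c

lemma gm_symm {x y : E n} (hx : x ∈ U) (hy : y ≠ 0) (i j : Fin n) : gm n F i j x y = gm n F j i x y := by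
  have := (hF.posdef x hx y hy).isHermitian.apply j i
  simpa [gmat] using this

lemma spray_eq {x y : E n} (hx : x ∈ U) (hy : y ≠ 0) (l : Fin n) :
    ∑ k, gm n F k l x y * Spray n F k x y = (1 / 4 : ℝ) *
    ((∑ k, pdx n (pdy n (F2 n F) l) k x y * y k) - pdx n (F2 n F) l x y) := by
  set c : Fin n → ℝ := fun l => (∑ k, pdx n (pdy n (F2 n F) l) k x y * y k) - pdx n (F2 n F) l x y
  have hS : (fun k => Spray n F k x y) = (1 / 4 : ℝ) • (ginv n F x y).mulVec c := by
    funext k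
    simp [Spray, Matrix.mulVec, dotProduct, c]
  have h1 : ∑ k, gm n F k l x y * Spray n F k x y = (gmat n F x y).mulVec (fun k => Spray n F k x y) l := by
    simp only [Matrix.mulVec, dotProduct, gmat, Matrix.of_apply]
    exact Finset.sum_congr rfl fun k _ => by rw [gm_symm hU hF hx hy]
  have hdet : IsUnit (gmat n F x y).det := (hF.posdef x hx y hy).det_pos.ne'.isUnit
  rw [h1, hS, Matrix.mulVec_smul, Matrix.mulVec_mulVec, ginv, Matrix.mul_nonsing_inv _ hdet,
    Matrix.one_mulVec]
  rfl

lemma setup : Setup U (lift (F2 n F)) (GG n F) where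
  hU := hU
  hQ := sm_F2 hF
  hG := sm_GG hU hF
  nQ := noV_lift _
  nG := fun _ => rfl
  euler := by
    intro p hp
    have h1 := (diffAt (isOpen_OO hU) (sm_F2 hF) hp).hasFDerivAt
    have h2 : HasDerivAt (fun t : ℝ => lift (F2 n F) (p + t • Yf n p)) (L (Yf n) (lift (F2 n F)) p) 0 :=
      h1.hasLineDerivAt _
    have h3 : (fun t : ℝ => lift (F2 n F) (p + t • Yf n p)) =ᶠ[𝓝 0]
        fun t => (1 + t) ^ 2 * lift (F2 n F) p := by
      filter_upwards [isOpen_Ioi.mem_nhds (show (0 : ℝ) ∈ Set.Ioi (-1 : ℝ) by simp)] with t ht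
      have ht' : 0 < 1 + t := by simp at ht; linarith
      have := hF.homog p.1 hp.1 p.2.1 hp.2 (1 + t) ht'
      have h5 : p.2.1 + t • p.2.1 = (1 + t) • p.2.1 := by module
      simp [lift, F2, h5, this]
      ring
    have h4 : HasDerivAt (fun t : ℝ => (1 + t) ^ 2 * lift (F2 n F) p)
        ((2 * (1 + 0) ^ 1 * 1) * lift (F2 n F) p) 0 := by
      simpa using ((((hasDerivAt_id (0 : ℝ)).const_add 1).pow 2).mul_const (lift (F2 n F) p))
    have := (h2.congr_of_eventuallyEq h3.symm).unique h4
    rw [this]; ring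
  el := by
    intro p hp
    rw [fderiv_LVQ hU hF hp, fderiv_lift hU (sm_F2 hF) hp]
    simp only [Pi.zero_apply, zero_mul, Finset.sum_const_zero, add_zero]
    refine Finset.sum_congr rfl fun l _ => ?_
    congr 1
    have h1 := spray_eq hU hF hp.1 hp.2 l
    have h2 : ∑ k, ((-2 : ℝ) • GG n F p) k * pdy n (pdy n (F2 n F) l) k p.1 p.2.1 =
        -4 * ∑ k, gm n F k l p.1 p.2.1 * Spray n F k p.1 p.2.1 := by
      rw [Finset.mul_sum]
      refine Finset.sum_congr rfl fun k _ => ?_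
      simp only [Pi.smul_apply, smul_eq_mul, GG, gm]
      ring
    have h3 : ∑ k, p.2.1 k * pdx n (pdy n (F2 n F) l) k p.1 p.2.1 =
      ∑ k, pdx n (pdy n (F2 n F) l) k p.1 p.2.1 * p.2.1 k :=
      Finset.sum_congr rfl fun k _ => mul_comm _ _
    rw [h2, h1, h3]
    ring

lemma g2_eq {p : T n} (hp : p ∈ OO n U) : g2 (lift (F2 n F)) p =
    ∑ l, ∑ k, p.2.2 l * p.2.2 k * pdy n (pdy n (F2 n F) l) k p.1 p.2.1 := by
  change fderiv ℝ (L (Vf n) (lift (F2 n F))) p (0, p.2.2, 0) = _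
  rw [fderiv_LVQ hU hF hp]
  simp only [Pi.zero_apply, zero_mul, Finset.sum_const_zero, add_zero, zero_add, Finset.mul_sum]
  exact Finset.sum_congr rfl fun l _ => Finset.sum_congr rfl fun k _ => by ring

lemma Rv_eq {p : T n} (hp : p ∈ OO n U) (i : Fin n) :
    Rv (GG n F) p i = ∑ k, RiemUp n F i k p.1 p.2.1 * p.2.2 k := by
  have hs := sm_spray hU hF
  have S := setup hU hF
  have comp : ∀ (f : T n → E n) (_ : ContDiffOn ℝ ∞ f (OO n U)) (q : T n) (_ : q ∈ OO n U) (w : T n),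
      fderiv ℝ f q w i = fderiv ℝ (fun z => f z i) q w := by
    intro f hf q hq w
    rw [fderiv_apply (diffAt S.op hf hq)]; rfl
  have hGi : (fun z => GG n F z i) = lift (Spray n F i) := rfl
  have hV : ∀ j, ∀ q ∈ OO n U, L (Vf n) (GG n F) q j = ∑ l, q.2.2 l * lift (pdy n (Spray n F j) l) q := by
    intro j q hq
    have : L (Vf n) (GG n F) q j = L (Vf n) (lift (Spray n F j)) q := by
      unfold L
      have h9 : fderiv ℝ (lift (Spray n F j)) q = _ := fderiv_apply (diffAt S.op S.hG hq) j
      rw [h9]; rfl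
    rw [this, LV_lift hU (hs j) hq]; rfl
  have h1 : L (Hf (GG n F)) (GG n F) p i = ∑ k, p.2.2 k * pdx n (Spray n F i) k p.1 p.2.1
      + ∑ k, - L (Vf n) (GG n F) p k * pdy n (Spray n F i) k p.1 p.2.1 := by
    unfold L
    rw [comp _ S.hG p hp, hGi]
    exact fderiv_lift hU (hs i) hp _ _ _
  have h2 : L (Df (GG n F)) (L (Vf n) (GG n F)) p i =
      ∑ l, (p.2.2 l * (∑ k, p.2.1 k * pdx n (pdy n (Spray n F i) l) k p.1 p.2.1
        + ∑ k, (-2 * Spray n F k p.1 p.2.1) * pdy n (pdy n (Spray n F i) l) k p.1 p.2.1)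
        + - L (Vf n) (GG n F) p l * pdy n (Spray n F i) l p.1 p.2.1) := by
    change fderiv ℝ (L (Vf n) (GG n F)) p _ i = _
    rw [comp _ (S.sV _ S.hG) p hp, L_congr S.op (hV i) hp]
    exact fderiv_lin hU (fun l => (hs i).dy hU l) hp _ _ _
  simp only [Rv, Pi.sub_apply, Pi.smul_apply, smul_eq_mul, h1, h2]
  have h3 : ∑ k, - L (Vf n) (GG n F) p k * pdy n (Spray n F i) k p.1 p.2.1 =
      - ∑ k, (∑ j, pdy n (Spray n F i) j p.1 p.2.1 * pdy n (Spray n F j) k p.1 p.2.1) * p.2.2 k := by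
    simp only [hV _ p hp, neg_mul, Finset.sum_neg_distrib, Finset.sum_mul]
    rw [Finset.sum_comm]
    congr 1
    exact Finset.sum_congr rfl fun k _ => Finset.sum_congr rfl fun j _ => by
      simp only [lift]; ring
  rw [Finset.sum_add_distrib, h3]
  simp only [RiemUp]
  have : ∀ k, (2 * pdx n (Spray n F i) k p.1 p.2.1
    - (∑ j, p.2.1 j * pdx n (pdy n (Spray n F i) k) j p.1 p.2.1)
    + 2 * (∑ j, Spray n F j p.1 p.2.1 * pdy n (pdy n (Spray n F i) k) j p.1 p.2.1)
    - ∑ j, pdy n (Spray n F i) j p.1 p.2.1 * pdy n (Spray n F j) k p.1 p.2.1) * p.2.2 k =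
    2 * (p.2.2 k * pdx n (Spray n F i) k p.1 p.2.1) -
     p.2.2 k * (∑ j, p.2.1 j * pdx n (pdy n (Spray n F i) k) j p.1 p.2.1
      + ∑ j, (-2 * Spray n F j p.1 p.2.1) * pdy n (pdy n (Spray n F i) k) j p.1 p.2.1)
     - (∑ j, pdy n (Spray n F i) j p.1 p.2.1 * pdy n (Spray n F j) k p.1 p.2.1) * p.2.2 k := by
    intro k
    have : ∑ j, (-2 * Spray n F j p.1 p.2.1) * pdy n (pdy n (Spray n F i) k) j p.1 p.2.1 =
      -2 * ∑ j, Spray n F j p.1 p.2.1 * pdy n (pdy n (Spray n F i) k) j p.1 p.2.1 := by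
      rw [Finset.mul_sum]
      exact Finset.sum_congr rfl fun j _ => by ring
    rw [this]; ring
  simp only [this, Finset.sum_sub_distrib, ← Finset.mul_sum]
  ring

lemma r4_eq {p : T n} (hp : p ∈ OO n U) : r4 (lift (F2 n F)) (GG n F) p =
    ∑ j, ∑ k, p.2.2 j * p.2.2 k * (4 * Rlow n F j k p.1 p.2.1) := by
  have S := setup hU hF
  rw [r4, S.Zg2 hp, fderiv_LVQ hU hF hp]
  simp only [Pi.zero_apply, zero_mul, Finset.sum_const_zero, add_zero, zero_add, Finset.mul_sum,
    Rv_eq hU hF hp, Rlow, Finset.sum_mul, gm]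
  refine Finset.sum_congr rfl fun j _ => ?_
  rw [Finset.sum_comm]
  refine Finset.sum_congr rfl fun k _ => Finset.sum_congr rfl fun i _ => ?_
  ring

lemma A4_eq {p : T n} (hp : p ∈ OO n U) : A4 (lift (F2 n F)) p =
    4 * ((F p.1 p.2.1) ^ 2 * ∑ j, ∑ k, hm n F j k p.1 p.2.1 * p.2.2 j * p.2.2 k) := by
  have hd : ∀ l, pdy n (F2 n F) l p.1 p.2.1 = 2 * F p.1 p.2.1 * Fy n F l p.1 p.2.1 := by
    intro l
    have h1 := (diffAt (isOpen_OO hU) (sm_F hF) hp).hasFDerivAt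
    rw [Fy, pdy_eq hU (sm_F2 hF) l hp, pdy_eq hU (sm_F hF) l hp]
    have h2 : fderiv ℝ (lift (F2 n F)) p = _ := (h1.pow 2).fderiv
    rw [h2]
    simp [lift]
  rw [A4, g2_eq hU hF hp, LVQ hU hF hp]
  simp only [lift, hd]
  have h1 : ∑ l, p.2.2 l * (2 * F p.1 p.2.1 * Fy n F l p.1 p.2.1) =
    2 * F p.1 p.2.1 * ∑ l, p.2.2 l * Fy n F l p.1 p.2.1 := by
    rw [Finset.mul_sum]; exact Finset.sum_congr rfl fun l _ => by ring
  have h2 : ∑ j, ∑ k, hm n F j k p.1 p.2.1 * p.2.2 j * p.2.2 k =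
     (1 / 2) * (∑ l, ∑ k, p.2.2 l * p.2.2 k * pdy n (pdy n (F2 n F) l) k p.1 p.2.1) -
     (∑ l, p.2.2 l * Fy n F l p.1 p.2.1) ^ 2 := by
    rw [sq, Finset.sum_mul_sum, Finset.mul_sum, ← Finset.sum_sub_distrib]
    refine Finset.sum_congr rfl fun j _ => ?_
    rw [Finset.mul_sum, ← Finset.sum_sub_distrib]
    refine Finset.sum_congr rfl fun k _ => ?_
    rw [hm, gm_symm hU hF hp.1 hp.2, gm]
    ring
  rw [h1, h2, F2]
  ring

lemma K_eq {p : T n} (hp : p ∈ OO n U) : K n F p.1 p.2.1 p.2.2 =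
    r4 (lift (F2 n F)) (GG n F) p / A4 (lift (F2 n F)) p := by
  have h1 : r4 (lift (F2 n F)) (GG n F) p = 4 * ∑ j, ∑ k, Rlow n F j k p.1 p.2.1 * p.2.2 j * p.2.2 k := by
    rw [r4_eq hU hF hp]
    simp only [Finset.mul_sum]
    exact Finset.sum_congr rfl fun j _ => Finset.sum_congr rfl fun k _ => by ring
  rw [A4_eq hU hF hp, h1, mul_div_mul_left _ _ (by norm_num)]
  rfl

end Fins
end Bridge

section Forms
open scoped ContDiff Topology
variable {n : ℕ} {U : Set (E n)}

/-- Bilinear form with given coefficients. -/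
def bil (M : Fin n → Fin n → ℝ) : E n →ₗ[ℝ] E n →ₗ[ℝ] ℝ :=
  LinearMap.mk₂ ℝ (fun u v => ∑ l, ∑ m, u l * v m * M l m)
    (fun u u' v => by simp [add_mul, Finset.sum_add_distrib])
    (fun c u v => by simp [mul_assoc, Finset.mul_sum])
    (fun u v v' => by simp [add_mul, mul_add, Finset.sum_add_distrib])
    (fun c u v => by simp [mul_assoc, mul_left_comm, Finset.mul_sum])

lemma bil_apply (M : Fin n → Fin n → ℝ) (u v : E n) :
    bil M u v = ∑ l, ∑ m, u l * v m * M l m := rfl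

/-- Trilinear form with given coefficients. -/
def tri (M : Fin n → Fin n → Fin n → ℝ) : E n →ₗ[ℝ] E n →ₗ[ℝ] E n →ₗ[ℝ] ℝ :=
  ∑ l, (LinearMap.proj (R := ℝ) (φ := fun _ : Fin n => ℝ) l).smulRight (bil (M l))

lemma tri_apply (M : Fin n → Fin n → Fin n → ℝ) (u v w : E n) :
    tri M u v w = ∑ l, ∑ m, ∑ k, u l * v m * w k * M l m k := by
  simp only [tri, LinearMap.sum_apply, LinearMap.smulRight_apply, LinearMap.smul_apply, bil_apply,
    LinearMap.proj_apply, smul_eq_mul, Finset.mul_sum]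
  exact Finset.sum_congr rfl fun l _ => Finset.sum_congr rfl fun m _ =>
    Finset.sum_congr rfl fun k _ => by ring

def ell (F : E n → E n → ℝ) (x y : E n) : E n →ₗ[ℝ] ℝ :=
  ∑ l, (pdy n (F2 n F) l x y) • LinearMap.proj (R := ℝ) (φ := fun _ : Fin n => ℝ) l

lemma ell_apply (F : E n → E n → ℝ) (x y v : E n) :
    ell F x y v = ∑ l, v l * pdy n (F2 n F) l x y := by
  simp [ell, LinearMap.sum_apply, mul_comm]

def bB (F : E n → E n → ℝ) (x y : E n) := bil fun l k => pdy n (pdy n (F2 n F) l) k x y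
def aB (F : E n → E n → ℝ) (x y : E n) : E n →ₗ[ℝ] E n →ₗ[ℝ] ℝ :=
  (2 * F2 n F x y) • bB F x y - (ell F x y).smulRight (ell F x y)
def rB (F : E n → E n → ℝ) (x y : E n) := bil fun j k => 2 * (Rlow n F j k x y + Rlow n F k j x y)
def cB (F : E n → E n → ℝ) (x y : E n) := tri fun l m k => pdy n (pdy n (pdy n (F2 n F) l) m) k x y
def tB (F : E n → E n → ℝ) (x y : E n) := tri fun l m k =>
  pdy n (fun x y => 4 * Rlow n F l m x y) k x y

lemma aB_apply (F : E n → E n → ℝ) (x y u v : E n) :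
    aB F x y u v = 2 * F2 n F x y * bB F x y u v - ell F x y u * ell F x y v := by
  simp [aB]

/-- abbreviations -/
abbrev QQ (F : E n → E n → ℝ) : T n → ℝ := lift (F2 n F)

variable {F : E n → E n → ℝ} (hU : IsOpen U) (hF : IsFinsler n U F)
  {x y : E n} (hx : x ∈ U) (hy : y ≠ 0)
include hU hF hx hy

lemma mem_OO (v : E n) : ((x, y, v) : T n) ∈ OO n U := ⟨hx, hy⟩

lemma ell_eq (v : E n) : L (Vf n) (QQ F) (x, y, v) = ell F x y v := by
  rw [ell_apply]; exact LVQ hU hF (mem_OO hU hF hx hy v)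

lemma ell_eq' (v w : E n) : fderiv ℝ (QQ F) (x, y, v) (0, w, 0) = ell F x y w := by
  rw [fderiv_lift hU (sm_F2 hF) (mem_OO hU hF hx hy v), ell_apply]; simp

lemma bB_eq (v : E n) : g2 (QQ F) (x, y, v) = bB F x y v v :=
  g2_eq hU hF (mem_OO hU hF hx hy v)

lemma aB_eq (v : E n) : A4 (QQ F) (x, y, v) = aB F x y v v := by
  rw [A4, bB_eq hU hF hx hy, ell_eq hU hF hx hy, aB_apply]
  simp only [lift]; ring

lemma rB_symm (u v : E n) : rB F x y u v = rB F x y v u := by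
  rw [rB, bil_apply, bil_apply, Finset.sum_comm]
  exact Finset.sum_congr rfl fun l _ => Finset.sum_congr rfl fun m _ => by ring

lemma rB_eq (v : E n) : r4 (QQ F) (GG n F) (x, y, v) = rB F x y v v := by
  rw [r4_eq hU hF (mem_OO hU hF hx hy v), rB, bil_apply]
  have h : ∑ j, ∑ k, v j * v k * (2 * Rlow n F k j x y) = ∑ j, ∑ k, v j * v k * (2 * Rlow n F j k x y) := by
    rw [Finset.sum_comm]
    exact Finset.sum_congr rfl fun l _ => Finset.sum_congr rfl fun m _ => by ring
  simp only [mul_add, Finset.sum_add_distrib]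
  rw [h, ← Finset.sum_add_distrib]
  simp only [← Finset.sum_add_distrib]
  exact Finset.sum_congr rfl fun l _ => Finset.sum_congr rfl fun m _ => by ring

lemma cB_eq (v : E n) : C3 (QQ F) (x, y, v) = cB F x y v v v := by
  have h := LV_quad hU (φ := fun l k => pdy n (pdy n (F2 n F) l) k)
    (fun l m => ((sm_F2 hF).dy hU l).dy hU m) (setup hU hF).sg2
    (fun q hq => g2_eq hU hF hq) (mem_OO hU hF hx hy v)
  rw [cB, tri_apply]
  exact h

lemma tB_eq (v : E n) : L (Vf n) (r4 (QQ F) (GG n F)) (x, y, v) = tB F x y v v v := by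
  have h := LV_quad hU (φ := fun l k x y => 4 * Rlow n F l k x y)
    (fun l m => (Sm.const 4).mul (sm_rlow hU hF l m)) (setup hU hF).sr4
    (fun q hq => r4_eq hU hF hq) (mem_OO hU hF hx hy v)
  rw [tB, tri_apply]
  exact h

lemma bB_gm (l k : Fin n) : pdy n (pdy n (F2 n F) l) k x y = 2 * gm n F k l x y := by
  rw [gm]; ring

lemma bB_symm (u v : E n) : bB F x y u v = bB F x y v u := by
  rw [bB, bil_apply, bil_apply, Finset.sum_comm]
  refine Finset.sum_congr rfl fun l _ => Finset.sum_congr rfl fun m _ => ?_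
  rw [bB_gm hU hF hx hy, bB_gm hU hF hx hy, gm_symm hU hF hx hy]; ring

lemma aB_symm (u v : E n) : aB F x y u v = aB F x y v u := by
  rw [aB_apply, aB_apply, bB_symm hU hF hx hy]; ring

lemma Fpos : 0 < F2 n F x y := pow_pos (hF.pos x hx y hy) 2

lemma bB_pos {v : E n} (hv : v ≠ 0) : 0 < bB F x y v v := by
  have h := (hF.posdef x hx y hy).dotProduct_mulVec_pos hv
  have h2 : bB F x y v v = 2 * (star v ⬝ᵥ (gmat n F x y).mulVec v) := by
    rw [bB, bil_apply]
    simp only [dotProduct, Matrix.mulVec, star_trivial, Finset.mul_sum, gmat, Matrix.of_apply]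
    refine Finset.sum_congr rfl fun l _ => Finset.sum_congr rfl fun m _ => ?_
    rw [bB_gm hU hF hx hy, gm_symm hU hF hx hy]; ring
  linarith

lemma ell_y : ell F x y y = 2 * F2 n F x y := by
  rw [← ell_eq' hU hF hx hy 0]
  exact (setup hU hF).euler _ (mem_OO hU hF hx hy 0)

lemma bB_y (v : E n) : bB F x y y v = ell F x y v := by
  have h := (setup hU hF).eulerD (mem_OO hU hF hx hy v)
  rw [ell_eq hU hF hx hy] at h
  change fderiv ℝ _ _ (0, y, 0) = _ at h
  rw [fderiv_LVQ hU hF (mem_OO hU hF hx hy v)] at h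
  rw [← h, bB_symm hU hF hx hy, bB, bil_apply]
  simp [Finset.mul_sum, mul_assoc]

lemma aB_y (v : E n) : aB F x y y v = 0 := by
  rw [aB_apply, bB_y hU hF hx hy, ell_y hU hF hx hy]; ring

lemma aB_sq (v : E n) : aB F x y v v = 2 * F2 n F x y *
    bB F x y (v - (ell F x y v / (2 * F2 n F x y)) • y) (v - (ell F x y v / (2 * F2 n F x y)) • y) := by
  have h0 := Fpos hU hF hx hy
  rw [aB_apply]
  simp only [map_sub, map_smul, LinearMap.sub_apply, LinearMap.smul_apply, smul_eq_mul]
  rw [bB_symm hU hF hx hy v y, bB_y hU hF hx hy, bB_y hU hF hx hy, ell_y hU hF hx hy]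
  field_simp
  ring

lemma aB_nonneg (v : E n) : 0 ≤ aB F x y v v := by
  rw [aB_sq hU hF hx hy]
  have h0 := Fpos hU hF hx hy
  by_cases h : (v - (ell F x y v / (2 * F2 n F x y)) • y) = 0
  · rw [h]; simp
  · have := bB_pos hU hF hx hy h
    positivity

lemma aB_zero {v : E n} (h : aB F x y v v = 0) : v = (ell F x y v / (2 * F2 n F x y)) • y := by
  by_contra h1
  have h2 := bB_pos hU hF hx hy (sub_ne_zero.2 h1)
  have h0 := Fpos hU hF hx hy
  rw [aB_sq hU hF hx hy] at h
  have : 0 < 2 * F2 n F x y *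
    bB F x y (v - (ell F x y v / (2 * F2 n F x y)) • y) (v - (ell F x y v / (2 * F2 n F x y)) • y) := by positivity
  linarith

lemma aB_li {v : E n} : LinearIndependent ℝ ![y, v] ↔ aB F x y v v ≠ 0 := by
  rw [LinearIndependent.pair_iff' hy]
  constructor
  · intro h h1
    exact h _ (aB_zero hU hF hx hy h1).symm
  · rintro h t rfl
    apply h
    simp [aB_y hU hF hx hy]

lemma K_eq' (v : E n) : K n F x y v = rB F x y v v / aB F x y v v := by
  have h := K_eq hU hF (mem_OO hU hF hx hy v)
  have h1 := rB_eq hU hF hx hy v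
  have h2 := aB_eq hU hF hx hy v
  rw [h1, h2] at h
  exact h

end Forms

section Sectional
open scoped ContDiff Topology
variable {n : ℕ} {U : Set (E n)}

def Pol (F : E n → E n → ℝ) (x y : E n) : Prop := ∃ k : ℝ, ∀ v, rB F x y v v = k * aB F x y v v

variable {F : E n → E n → ℝ} (hn : 2 ≤ n) (hU : IsOpen U) (hF : IsFinsler n U F)
  (hsec : SectionalFlagCurv n U F) {x y : E n} (hx : x ∈ U) (hy : y ≠ 0)
include hn hU hF hsec hx hy

lemma exists_indep : ∃ v, aB F x y v v ≠ 0 := by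
  have h1 : 1 < Module.finrank ℝ (E n) := by simp; omega
  obtain ⟨v, hv⟩ := exists_linearIndependent_pair_of_one_lt_finrank h1 hy
  exact ⟨v, (aB_li hU hF hx hy).1 hv⟩

lemma sec_eq {v y' v' : E n} (hy' : y' ≠ 0) (h : aB F x y v v ≠ 0) (h' : aB F x y' v' v' ≠ 0)
    (hs : Submodule.span ℝ {y, v} = Submodule.span ℝ {y', v'}) :
    rB F x y v v * aB F x y' v' v' = rB F x y' v' v' * aB F x y v v := by
  have := hsec x hx y v y' v' ((aB_li hU hF hx hy).2 h) ((aB_li hU hF hx hy').2 h') hs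
  rw [K_eq' hU hF hx hy, K_eq' hU hF hx hy', div_eq_div_iff h h'] at this
  exact this

lemma span_shift (y v : E n) (t : ℝ) :
    Submodule.span ℝ {y, v} = Submodule.span ℝ {y, v + t • y} := by
  apply le_antisymm <;> rw [Submodule.span_le] <;> intro z hz <;>
    simp only [Set.mem_insert_iff, Set.mem_singleton_iff] at hz <;>
    rw [SetLike.mem_coe, Submodule.mem_span_pair] <;> rcases hz with rfl | rfl
  · exact ⟨1, 0, by simp⟩
  · exact ⟨-t, 1, by module⟩
  · exact ⟨1, 0, by simp⟩
  · exact ⟨t, 1, by module⟩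

lemma rB_y (v : E n) : rB F x y y v = 0 := by
  have key : ∀ v, aB F x y v v ≠ 0 → rB F x y y v = 0 ∧ rB F x y y y = 0 := by
    intro v hv
    have h1 : ∀ t : ℝ, aB F x y (v + t • y) (v + t • y) = aB F x y v v := by
      intro t
      simp [aB_y hU hF hx hy, aB_symm hU hF hx hy v y]
    have h2 : ∀ t : ℝ, rB F x y (v + t • y) (v + t • y) = rB F x y v v := by
      intro t
      have := sec_eq hn hU hF hsec hx hy hy hv (by rw [h1]; exact hv)
        (span_shift hn hU hF hsec hx hy y v t)
      rw [h1] at this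
      exact (mul_right_cancel₀ hv this).symm
    have h3 := h2 1
    have h4 := h2 (-1)
    simp only [map_add, map_smul, LinearMap.add_apply, LinearMap.smul_apply, smul_eq_mul,
      rB_symm hU hF hx hy v y] at h3 h4
    constructor <;> linarith
  obtain ⟨w, hw⟩ := exists_indep hn hU hF hsec hx hy
  by_cases hv : aB F x y v v = 0
  · rw [aB_zero hU hF hx hy hv, map_smul, (key w hw).2, smul_zero]
  · exact (key v hv).1

lemma sec_der {v : E n} (hv : aB F x y v v ≠ 0) :
    tB F x y v v v * aB F x y v v = rB F x y v v * (2 * F2 n F x y * cB F x y v v v) := by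
  have S := setup hU hF
  have hp := mem_OO hU hF hx hy v
  have hli := (aB_li hU hF hx hy).2 hv
  have h1 : HasDerivAt (fun t : ℝ => r4 (QQ F) (GG n F) ((x, y, v) + t • Vf n (x, y, v))) _ 0 :=
    (diffAt S.op S.sr4 hp).hasFDerivAt.hasLineDerivAt _
  have h2 : HasDerivAt (fun t : ℝ => A4 (QQ F) ((x, y, v) + t • Vf n (x, y, v))) _ 0 :=
    (diffAt S.op S.sA4 hp).hasFDerivAt.hasLineDerivAt _
  have h3 : (fun t : ℝ => r4 (QQ F) (GG n F) ((x, y, v) + t • Vf n (x, y, v)) * aB F x y v v) =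
     fun t : ℝ => rB F x y v v * A4 (QQ F) ((x, y, v) + t • Vf n (x, y, v)) := by
    funext t
    have e1 : ((x, y, v) : T n) + t • Vf n (x, y, v) = (x, y + t • v, v) := by simp
    have hli' : LinearIndependent ℝ ![y + t • v, v] := by
      rw [LinearIndependent.pair_iff] at hli ⊢
      intro a b hab
      have := hli a (a * t + b) (by rw [← hab]; module)
      obtain ⟨rfl, h⟩ := this
      simpa using h
    have hy' : y + t • v ≠ 0 := by
      have := hli'.ne_zero 0
      simpa using this
    have hv' := (aB_li hU hF hx hy').1 hli'
    have hs : Submodule.span ℝ {y, v} = Submodule.span ℝ {y + t • v, v} := by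
      rw [Set.pair_comm, span_shift hn hU hF hsec hx hy v y t, Set.pair_comm]
    have h4 := sec_eq hn hU hF hsec hx hy hy' hv hv' hs
    have h5 := rB_eq hU hF hx hy' v
    have h6 := aB_eq hU hF hx hy' v
    rw [e1, h5, h6, h4]
  have h4 := h1.mul_const (aB F x y v v)
  have h5 := h2.const_mul (rB F x y v v)
  rw [h3] at h4
  have h6 := h4.unique h5
  have h7 := tB_eq hU hF hx hy v
  have h8 := S.VA4 hp
  have h9 := cB_eq hU hF hx hy v
  rw [h9] at h8
  unfold L at h7 h8
  rw [h7, h8] at h6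
  exact h6

lemma not_pol (h : ¬ Pol F x y) : ∃ v w, rB F x y v v * aB F x y w w ≠ rB F x y w w * aB F x y v v := by
  by_contra! h1
  obtain ⟨w, hw⟩ := exists_indep hn hU hF hsec hx hy
  refine h ⟨rB F x y w w / aB F x y w w, fun v => ?_⟩
  have := h1 v w
  field_simp
  linarith

lemma ker_pos {v : E n} (h : ell F x y v = 0) (hv : v ≠ 0) : 0 < aB F x y v v := by
  refine lt_of_le_of_ne (aB_nonneg hU hF hx hy v) fun h0 => hv ?_
  have := aB_zero hU hF hx hy h0.symm
  rw [h] at this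
  simpa using this

lemma C_div (h : ¬ Pol F x y) : ∃ I : E n →ₗ[ℝ] ℝ, ∀ v, cB F x y v v v = aB F x y v v * I v := by
  have hq := Fpos hU hF hx hy
  have hl : ell F x y y ≠ 0 := by rw [ell_y hU hF hx hy]; positivity
  obtain ⟨e1, l, he, hl⟩ := exists_eigen hn (aB F x y) (rB F x y) (aB_symm hU hF hx hy)
    (rB_symm hU hF hx hy) y (ell F x y) hl (fun v h1 h2 => ker_pos hn hU hF hsec hx hy h1 h2)
    (aB_y hU hF hx hy) (rB_y hn hU hF hsec hx hy)
  obtain ⟨v0, hv0⟩ : ∃ v0, rB F x y v0 v0 - l * aB F x y v0 v0 ≠ 0 := by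
    by_contra! h1
    exact h ⟨l, fun v => by have := h1 v; linarith⟩
  refine div_cubic (aB F x y) (rB F x y) (aB_symm hU hF hx hy)
    (rB_symm hU hF hx hy) (cB F x y) (fun v => tB F x y v v v / (2 * F2 n F x y)) ?_ e1 l he hl v0 hv0 ?_
  · intro u w
    set t := tB F x y
    set q := 2 * F2 n F x y
    refine ⟨t w w w / q, (t u w w + t w u w + t w w u) / q, (t u u w + t u w u + t w u u) / q,
      t u u u / q, fun s => ?_⟩
    simp only [map_add, map_smul, LinearMap.add_apply, LinearMap.smul_apply, smul_eq_mul]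
    ring
  · intro v hv
    by_cases ha : aB F x y v v = 0
    · exfalso
      apply hv
      rw [aB_zero hU hF hx hy ha]
      simp [rB_y hn hU hF hsec hx hy, aB_y hU hF hx hy]
    · have := sec_der hn hU hF hsec hx hy ha
      field_simp
      linarith

end Sectional

section Local
open scoped ContDiff Topology
variable {n : ℕ} {U : Set (E n)}

/-- Replace the third component. -/
def fr (c : E n) (p : T n) : T n := (p.1, p.2.1, c)

lemma fr_smooth (c : E n) : ContDiff ℝ ∞ (fr c) := by unfold fr; fun_prop

def IfF (F : E n → E n → ℝ) (a : E n) (p : T n) : ℝ :=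
  (fderiv ℝ (C3 (QQ F)) (fr a p) (0, 0, p.2.2) - fderiv ℝ (A4 (QQ F)) (fr a p) (0, 0, p.2.2) *
    C3 (QQ F) (fr a p) / A4 (QQ F) (fr a p)) / A4 (QQ F) (fr a p)

/-- `f` is linear in `v`. -/
def LinV (O : Set (T n)) (f : T n → ℝ) : Prop := ∀ x y u v : E n, ∀ s t : ℝ, (x, y, u) ∈ O →
  f (x, y, s • u + t • v) = s * f (x, y, u) + t * f (x, y, v)

variable {F : E n → E n → ℝ}

def OP (U : Set (E n)) (F : E n → E n → ℝ) (v0 w0 a : E n) : Set (T n) :=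
  {p | p ∈ OO n U ∧ (r4 (QQ F) (GG n F) (fr v0 p) * A4 (QQ F) (fr w0 p)
    - r4 (QQ F) (GG n F) (fr w0 p) * A4 (QQ F) (fr v0 p)) * A4 (QQ F) (fr a p) ≠ 0}

lemma linDiv {p : T n} {f g : T n → ℝ} (hf : DifferentiableAt ℝ f p) (hg : DifferentiableAt ℝ g p)
    (I : E n →ₗ[ℝ] ℝ) (h : ∀ v, f (p.1, p.2.1, v) = g (p.1, p.2.1, v) * I v) (w : E n) :
    fderiv ℝ f p (0, 0, w) = fderiv ℝ g p (0, 0, w) * I p.2.2 + g p * I w := by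
  have h1 : HasDerivAt (fun t : ℝ => f (p + t • ((0, 0, w) : T n))) (fderiv ℝ f p (0,0,w)) 0 :=
    hf.hasFDerivAt.hasLineDerivAt _
  have h2 : HasDerivAt (fun t : ℝ => g (p + t • ((0, 0, w) : T n))) (fderiv ℝ g p (0,0,w)) 0 :=
    hg.hasFDerivAt.hasLineDerivAt _
  have h3 : (fun t : ℝ => f (p + t • ((0, 0, w) : T n))) =
    fun t : ℝ => g (p + t • ((0, 0, w) : T n)) * (I p.2.2 + t * I w) := by
    funext t
    have e1 : p + t • ((0, 0, w) : T n) = (p.1, p.2.1, p.2.2 + t • w) := by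
      refine Prod.ext ?_ (Prod.ext ?_ ?_) <;> simp
    rw [e1, h]; simp
  have h4 : HasDerivAt (fun t : ℝ => I p.2.2 + t * I w) (1 * I w) 0 :=
    ((hasDerivAt_id (0 : ℝ)).mul_const (I w)).const_add _
  have h5 := h2.mul h4
  rw [h3] at h1
  have := h1.unique h5
  rw [this]; simp

lemma IfF_lin (O : Set (T n)) (a : E n) : LinV O (IfF F a) := by
  intro x y u v s t _
  have h : ((0, 0, s • u + t • v) : T n) = s • ((0, 0, u) : T n) + t • ((0, 0, v) : T n) := by simp
  simp only [IfF, fr, h, map_add, map_smul, smul_eq_mul]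
  ring

section
variable (hU : IsOpen U) (hF : IsFinsler n U F)
include hU hF

lemma OP_open (v0 w0 a : E n) : IsOpen (OP U F v0 w0 a) := by
  have S := setup hU hF
  have hm : ∀ c, Set.MapsTo (fr c) (OO n U) (OO n U) := fun c p hp => hp
  have hr : ∀ c, ContinuousOn (fun p => r4 (QQ F) (GG n F) (fr c p)) (OO n U) := fun c =>
    (S.sr4.comp (fr_smooth c).contDiffOn (hm c)).continuousOn
  have ha : ∀ c, ContinuousOn (fun p => A4 (QQ F) (fr c p)) (OO n U) := fun c =>
    (S.sA4.comp (fr_smooth c).contDiffOn (hm c)).continuousOn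
  have := ((((hr v0).mul (ha w0)).sub ((hr w0).mul (ha v0))).mul (ha a)).isOpen_inter_preimage S.op
    (isOpen_compl_singleton (x := (0 : ℝ)))
  exact this

lemma IfF_smooth (v0 w0 a : E n) : ContDiffOn ℝ ∞ (IfF F a) (OP U F v0 w0 a) := by
  have S := setup hU hF
  have hm : Set.MapsTo (fr a) (OP U F v0 w0 a) (OO n U) := fun p hp => hp.1
  have hc := S.sC3.comp (fr_smooth a).contDiffOn hm
  have ha := S.sA4.comp (fr_smooth a).contDiffOn hm
  have hdc := (S.sC3.fderiv_of_isOpen S.op (m := ∞) (by simp)).comp (fr_smooth a).contDiffOn hm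
  have hda := (S.sA4.fderiv_of_isOpen S.op (m := ∞) (by simp)).comp (fr_smooth a).contDiffOn hm
  have hz : ContDiffOn ℝ ∞ (fun p : T n => ((0, 0, p.2.2) : T n)) (OP U F v0 w0 a) := by fun_prop
  have hne : ∀ p ∈ OP U F v0 w0 a, A4 (QQ F) (fr a p) ≠ 0 := fun p hp => right_ne_zero_of_mul hp.2
  exact ((hdc.clm_apply hz).sub (((hda.clm_apply hz).mul hc).div ha hne)).div ha hne

lemma LVG_eq {q : T n} (hq : q ∈ OO n U) (j : Fin n) :
    L (Vf n) (GG n F) q j = ∑ l, q.2.2 l * pdy n (Spray n F j) l q.1 q.2.1 := by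
  have S := setup hU hF
  have : L (Vf n) (GG n F) q j = L (Vf n) (lift (Spray n F j)) q := by
    unfold L
    have h9 : fderiv ℝ (lift (Spray n F j)) q = _ := fderiv_apply (diffAt S.op S.hG hq) j
    rw [h9]; rfl
  rw [this, LV_lift hU (sm_spray hU hF j) hq]

lemma D_lin {O : Set (T n)} (hO : IsOpen O) (hOO : O ⊆ OO n U)
    (hv : ∀ p ∈ O, ∀ c, fr c p ∈ O) {f : T n → ℝ} (hf : ContDiffOn ℝ ∞ f O) (hl : LinV O f) :
    LinV O (L (Df (GG n F)) f) := by
  intro x y u v s t hp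
  have key : ∀ w, HasDerivAt (fun τ : ℝ => f ((x, y, w) + τ • Df (GG n F) (x, y, w)))
      (L (Df (GG n F)) f (x, y, w)) 0 := fun w =>
    (diffAt hO hf (hv _ hp w)).hasFDerivAt.hasLineDerivAt _
  have hN : L (Vf n) (GG n F) (x, y, s • u + t • v) = s • L (Vf n) (GG n F) (x, y, u) +
      t • L (Vf n) (GG n F) (x, y, v) := by
    funext j
    simp only [Pi.add_apply, Pi.smul_apply, smul_eq_mul]
    have hm : ∀ w, ((x, y, w) : T n) ∈ OO n U := fun w => hOO (hv _ hp w)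
    rw [LVG_eq hU hF (hm (s • u + t • v)), LVG_eq hU hF (hm u), LVG_eq hU hF (hm v)]
    simp [add_mul, Finset.sum_add_distrib, Finset.mul_sum, mul_assoc]
  have h1 := ((key u).const_mul s).add ((key v).const_mul t)
  have h2 : (fun τ : ℝ => f ((x, y, s • u + t • v) + τ • Df (GG n F) (x, y, s • u + t • v))) =ᶠ[𝓝 0]
      fun τ => s * f ((x, y, u) + τ • Df (GG n F) (x, y, u)) + t * f ((x, y, v) + τ • Df (GG n F) (x, y, v)) := by
    have hc : Continuous fun τ : ℝ => ((x, y, u) : T n) + τ • Df (GG n F) (x, y, u) := by fun_prop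
    have hmem : ∀ᶠ τ in 𝓝 (0 : ℝ), ((x, y, u) : T n) + τ • Df (GG n F) (x, y, u) ∈ O :=
      hc.continuousAt.eventually_mem (hO.mem_nhds (by simpa using hp))
    filter_upwards [hmem] with τ hτ
    have e1 : ∀ w, ((x, y, w) : T n) + τ • Df (GG n F) (x, y, w) =
      (x + τ • y, y + τ • (-2 : ℝ) • GG n F (x, y, 0), w - τ • L (Vf n) (GG n F) (x, y, w)) := by
      intro w
      refine Prod.ext rfl (Prod.ext rfl ?_)
      simp [Df, sub_eq_add_neg]
    rw [e1] at hτ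
    rw [e1, e1, e1, hN, ← hl _ _ _ _ _ _ hτ]
    congr 3
    module
  exact (key _).unique (h1.congr_of_eventuallyEq h2)

lemma DDprod {O : Set (T n)} (hO : IsOpen O) (hOO : O ⊆ OO n U) {f : T n → ℝ}
    (hf : ContDiffOn ℝ ∞ f O) (h : T n → ℝ) (he : ∀ p ∈ O, h p = A4 (QQ F) p * f p) {p : T n}
    (hp : p ∈ O) : L (Df (GG n F)) h p = A4 (QQ F) p * L (Df (GG n F)) f p := by
  have S := setup hU hF
  change fderiv ℝ _ _ _ = _
  rw [L_congr hO he hp]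
  have h1 := ((diffAt S.op S.sA4 (hOO hp)).hasFDerivAt.mul (diffAt hO hf hp).hasFDerivAt).fderiv
  have h2 := S.DA4 (hOO hp)
  unfold L at h2
  change fderiv ℝ (A4 (QQ F) * f) p _ = _
  rw [h1]
  simp only [_root_.add_apply, _root_.smul_apply, smul_eq_mul, h2]
  simp [L]

end

variable (hn : 2 ≤ n) (hU : IsOpen U) (hF : IsFinsler n U F)
  (hsec : SectionalFlagCurv n U F) {x y : E n} (hx : x ∈ U) (hy : y ≠ 0)
include hn hU hF hsec

lemma OP_notpol {v0 w0 a : E n} {p : T n} (hp : p ∈ OP U F v0 w0 a) : ¬ Pol F p.1 p.2.1 := by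
  rintro ⟨k, hk⟩
  have h := left_ne_zero_of_mul hp.2
  apply h
  have e1 := fun c => rB_eq hU hF hp.1.1 hp.1.2 c
  have e2 := fun c => aB_eq hU hF hp.1.1 hp.1.2 c
  simp only [fr, e1, e2, hk]
  ring

lemma IfF_eq {v0 w0 a : E n} {p : T n} (hp : p ∈ OP U F v0 w0 a) (I : E n →ₗ[ℝ] ℝ)
    (hI : ∀ v, cB F p.1 p.2.1 v v v = aB F p.1 p.2.1 v v * I v) : IfF F a p = I p.2.2 := by
  have S := setup hU hF
  have ha := right_ne_zero_of_mul hp.2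
  have e1 := fun c => cB_eq hU hF hp.1.1 hp.1.2 c
  have e2 := fun c => aB_eq hU hF hp.1.1 hp.1.2 c
  have h0 : ∀ v, C3 (QQ F) (p.1, p.2.1, v) = A4 (QQ F) (p.1, p.2.1, v) * I v := by
    intro v; rw [e1, e2, hI]
  have hp' : fr a p ∈ OO n U := hp.1
  have h1 := linDiv (diffAt S.op S.sC3 hp') (diffAt S.op S.sA4 hp') I h0 p.2.2
  have h2 : C3 (QQ F) (fr a p) = A4 (QQ F) (fr a p) * I a := h0 a
  rw [IfF, h1, h2]
  change (_ * I a + _ - _) / _ = _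
  field_simp
  ring

lemma C_eq_If {v0 w0 a : E n} {p : T n} (hp : p ∈ OP U F v0 w0 a) :
    C3 (QQ F) p = A4 (QQ F) p * IfF F a p := by
  obtain ⟨I, hI⟩ := C_div hn hU hF hsec hp.1.1 hp.1.2 (OP_notpol hn hU hF hsec hp)
  rw [IfF_eq hn hU hF hsec hp I hI]
  have e1 := cB_eq hU hF hp.1.1 hp.1.2 p.2.2
  have e2 := aB_eq hU hF hp.1.1 hp.1.2 p.2.2
  have e3 := hI p.2.2
  rw [← e1, ← e2] at e3
  exact e3

include hx hy

lemma C_zero (hnp : ¬ Pol F x y) (v : E n) : cB F x y v v v = 0 := by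
  have S := setup hU hF
  obtain ⟨I, hI⟩ := C_div hn hU hF hsec hx hy hnp
  obtain ⟨v0, w0, h0⟩ := not_pol hn hU hF hsec hx hy hnp
  obtain ⟨a, ha⟩ := exists_indep hn hU hF hsec hx hy
  have q0 := Fpos hU hF hx hy
  have e1 := fun c => cB_eq hU hF hx hy c
  have e2 := fun c => aB_eq hU hF hx hy c
  have e3 := fun c => rB_eq hU hF hx hy c
  have hO := OP_open hU hF v0 w0 a
  set O := OP U F v0 w0 a with hOd
  have hOO : O ⊆ OO n U := fun p hp => hp.1
  have hp : ∀ v, ((x, y, v) : T n) ∈ O := by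
    intro v
    refine ⟨⟨hx, hy⟩, ?_⟩
    simp only [fr, e2, e3]
    exact mul_ne_zero (sub_ne_zero.2 h0) ha
  have hfr : ∀ p ∈ O, ∀ c, fr c p ∈ O := fun p hp c => ⟨hp.1, hp.2⟩
  have sI := IfF_smooth hU hF v0 w0 a
  have sDI : ContDiffOn ℝ ∞ (L (Df (GG n F)) (IfF F a)) O := L_smooth hO (S.sD.mono hOO) sI
  set J := L (Df (GG n F)) (L (Df (GG n F)) (IfF F a)) with hJ
  have lJ : LinV O J := D_lin hU hF hO hOO hfr sDI (D_lin hU hF hO hOO hfr sI (IfF_lin O a))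
  have hDD : ∀ v, L (Df (GG n F)) (L (Df (GG n F)) (C3 (QQ F))) (x, y, v) = aB F x y v v * J (x, y, v) := by
    intro v
    rw [← e2]
    exact DDprod hU hF hO hOO sDI _ (fun q hq => DDprod hU hF hO hOO sI _
      (fun q' hq' => C_eq_If hn hU hF hsec hq') hq) (hp v)
  have h0' : ∀ v, C3 (QQ F) (x, y, v) = A4 (QQ F) (x, y, v) * I v := by
    intro v; rw [e1, e2, hI]
  have hZ : ∀ v w, 3 * fderiv ℝ (g2 (QQ F)) (x, y, v) (0, w, 0) =
      fderiv ℝ (A4 (QQ F)) (x, y, v) (0, 0, w) * I v + aB F x y v v * I w := by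
    intro v w
    rw [← S.ZC3 (hOO (hp v)), ← e2]
    exact linDiv (diffAt S.op S.sC3 (hOO (hp v))) (diffAt S.op S.sA4 (hOO (hp v))) I h0' w
  have hmain : ∀ v, ell F x y v = 0 → rB F x y v v * I v = aB F x y v v *
      ((I (Rv (GG n F) (x, y, v)) / 3 - J (x, y, v)) / (4 / 3 * F2 n F x y)) := by
    intro v hv
    by_cases hv0 : v = 0
    · subst hv0; simp
    have hpos := ker_pos hn hU hF hsec hx hy hv hv0
    have h1 := S.DDC3 (hOO (hp v))
    have h2 := tB_eq hU hF hx hy v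
    have h3 := sec_der hn hU hF hsec hx hy hpos.ne'
    have h4 : tB F x y v v v = rB F x y v v * (2 * F2 n F x y * I v) := by
      apply mul_right_cancel₀ hpos.ne'
      rw [h3, hI]; ring
    have h5 := S.ZA4 (hOO (hp v)) (Rv (GG n F) (x, y, v))
    have h6 : L (Vf n) (QQ F) (x, y, v) = 0 := by rw [ell_eq hU hF hx hy, hv]
    have h7 : fderiv ℝ (g2 (QQ F)) (x, y, v) (0, 0, Rv (GG n F) (x, y, v)) = rB F x y v v := e3 v
    have h8 := hZ v (Rv (GG n F) (x, y, v))
    have h9 : lift (F2 n F) (x, y, v) = F2 n F x y := rfl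
    rw [h6, h7, h9] at h5
    rw [h5] at h8
    rw [hDD, h2, h4] at h1
    rw [mul_div_assoc', eq_div_iff (by positivity)]
    linear_combination h1 + (1 / 3) * h8
  have hIker : ∀ u, ell F x y u = 0 → I u = 0 := by
    intro u hu
    by_contra hIu
    obtain ⟨k, hk⟩ := div_lin (aB F x y) (rB F x y) (ell F x y) I
      (fun v => (I (Rv (GG n F) (x, y, v)) / 3 - J (x, y, v)) / (4 / 3 * F2 n F x y))
      (by
        intro s t u v
        have hR : Rv (GG n F) (x, y, s • u + t • v) = s • Rv (GG n F) (x, y, u) + t • Rv (GG n F) (x, y, v) := by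
          funext i
          simp only [Pi.add_apply, Pi.smul_apply, smul_eq_mul]
          rw [Rv_eq hU hF (hOO (hp _)), Rv_eq hU hF (hOO (hp _)), Rv_eq hU hF (hOO (hp _))]
          simp only [Pi.add_apply, Pi.smul_apply, smul_eq_mul, mul_add, Finset.sum_add_distrib,
            Finset.mul_sum]
          congr 1 <;> exact Finset.sum_congr rfl fun _ _ => by ring
        simp only [hR, lJ x y u v s t (hp u), map_add, map_smul, smul_eq_mul]
        ring)
      (by
        intro v h1 h2
        by_contra h3
        exact (ker_pos hn hU hF hsec hx hy h1 h3).ne' h2)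
      hmain u hu hIu
    apply hnp
    refine ⟨k, fun v => ?_⟩
    set t := ell F x y v / (2 * F2 n F x y)
    have h1 : ell F x y (v - t • y) = 0 := by
      simp only [map_sub, map_smul, ell_y hU hF hx hy, smul_eq_mul, t]
      field_simp
      ring
    have h2 := hk _ h1
    simpa [rB_y hn hU hF hsec hx hy, aB_y hU hF hx hy, rB_symm hU hF hx hy v y,
      aB_symm hU hF hx hy v y] using h2
  have hIy : I y = 0 := by
    have h1 := hZ a y
    have h2 := S.eulerG (hOO (hp a))
    have h3 := S.ZA4 (hOO (hp a)) y
    have h4 := S.Zg2 (hOO (hp a)) y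
    have h5 := S.eulerD (hOO (hp a))
    have h6 := ell_eq' hU hF hx hy a y
    have h7 := ell_y hU hF hx hy
    have h8 : lift (F2 n F) (x, y, a) = F2 n F x y := rfl
    change fderiv ℝ (L (Vf n) (QQ F)) (x, y, a) (0, y, 0) = _ at h5
    change fderiv ℝ (g2 (QQ F)) (x, y, a) (0, y, 0) = 0 at h2
    rw [h4, h5, h6, h7, h8] at h3
    rw [h2, h3] at h1
    have : aB F x y a a * I y = 0 := by linarith
    exact (mul_eq_zero.1 this).resolve_left ha
  have hI0 : I v = 0 := by
    set t := ell F x y v / (2 * F2 n F x y)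
    have h1 : ell F x y (v - t • y) = 0 := by
      simp only [map_sub, map_smul, ell_y hU hF hx hy, smul_eq_mul, t]
      field_simp
      ring
    have h2 := hIker _ h1
    simpa [hIy] using h2
  rw [hI, hI0, mul_zero]

end Local

section Final
open scoped ContDiff Topology
variable {n : ℕ} {U : Set (E n)} {F : E n → E n → ℝ}

lemma quad_zero (b : E n →ₗ[ℝ] E n →ₗ[ℝ] ℝ) (y : E n) (h : ∀ᶠ v in 𝓝 y, b v v = 0) (u : E n) :
    b u u = 0 := by
  have hc : Continuous fun t : ℝ => y + t • u := by fun_prop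
  have h1 : ∀ᶠ t in 𝓝 (0 : ℝ), b (y + t • u) (y + t • u) = 0 := by
    have : Filter.Tendsto (fun t : ℝ => y + t • u) (𝓝 0) (𝓝 y) := by
      simpa using hc.tendsto 0
    exact this.eventually h
  obtain ⟨ε, hε, h2⟩ := Metric.eventually_nhds_iff.1 h1
  have a0 := h.self_of_nhds
  have a1 := h2 (y := ε / 2) (by simp [abs_of_pos hε]; linarith)
  have a2 := h2 (y := -(ε / 2)) (by simp [abs_of_pos hε]; linarith)
  simp only [map_add, map_smul, LinearMap.add_apply, LinearMap.smul_apply, smul_eq_mul] at a1 a2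
  have : ε ^ 2 * b u u = 0 := by linear_combination 2 * a1 + 2 * a2 - 4 * a0
  exact (mul_eq_zero.1 this).resolve_left (by positivity)

variable (hn : 2 ≤ n) (hU : IsOpen U) (hF : IsFinsler n U F)
  (hsec : SectionalFlagCurv n U F) {x : E n} (hx : x ∈ U)
include hn hU hF hsec hx

lemma li_swap {y v : E n} (h : LinearIndependent ℝ ![y, v]) : LinearIndependent ℝ ![v, y] := by
  rw [LinearIndependent.pair_iff] at h ⊢
  intro s t hst
  exact (h t s (by rw [← hst, add_comm])).symm

lemma li_ne {y v : E n} (h : LinearIndependent ℝ ![y, v]) : y ≠ 0 := by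
  simpa using h.ne_zero 0

lemma pol_one {y v : E n} (h : LinearIndependent ℝ ![y, v]) {k' : ℝ}
    (hk' : ∀ w, rB F x v w w = k' * aB F x v w w) : rB F x y v v = k' * aB F x y v v := by
  have h' := li_swap hn hU hF hsec hx h
  have hy := li_ne hn hU hF hsec hx h
  have hv := li_ne hn hU hF hsec hx h'
  have h1 := (aB_li hU hF hx hy).1 h
  have h2 := (aB_li hU hF hx hv).1 h'
  have h3 := sec_eq hn hU hF hsec hx hy hv h1 h2 (by rw [Set.pair_comm])
  rw [hk'] at h3
  apply mul_right_cancel₀ h2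
  rw [h3]; ring

lemma pol_two {y v : E n} (h : LinearIndependent ℝ ![y, v]) {k k' : ℝ}
    (hk : ∀ w, rB F x y w w = k * aB F x y w w)
    (hk' : ∀ w, rB F x v w w = k' * aB F x v w w) : k = k' := by
  have h1 := pol_one hn hU hF hsec hx h hk'
  rw [hk] at h1
  exact mul_right_cancel₀ ((aB_li hU hF hx (li_ne hn hU hF hsec hx h)).1 h) h1

lemma iso_of_pol (hp : ∀ y, y ≠ 0 → Pol F x y) : IsotropicAt n F x := by
  choose! k hk using hp
  have : Nontrivial (E n) := by
    have : Nonempty (Fin n) := ⟨⟨0, by omega⟩⟩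
    infer_instance
  obtain ⟨y0, hy0⟩ := exists_ne (0 : E n)
  refine ⟨k y0, fun y v h => ?_⟩
  have hy := li_ne hn hU hF hsec hx h
  have h' := li_swap hn hU hF hsec hx h
  have hv := li_ne hn hU hF hsec hx h'
  have h1 := (aB_li hU hF hx hy).1 h
  rw [K_eq' hU hF hx hy, hk y hy, mul_div_assoc, div_self h1, mul_one]
  by_cases h2 : LinearIndependent ℝ ![y0, y]
  · exact (pol_two hn hU hF hsec hx h2 (hk y0 hy0) (hk y hy)).symm
  · have h3 : LinearIndependent ℝ ![y0, v] := by
      rw [LinearIndependent.pair_iff' hy0] at h2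
      push Not at h2
      obtain ⟨s, rfl⟩ := h2
      rw [LinearIndependent.pair_iff'] at h ⊢
      · rintro t rfl
        have hs : s ≠ 0 := by rintro rfl; simp at hy
        exact h (t * s⁻¹) (by rw [smul_smul]; congr 1; field_simp)
      · exact hy0
      · exact hy
    rw [pol_two hn hU hF hsec hx h (hk y hy) (hk v hv)]
    exact (pol_two hn hU hF hsec hx h3 (hk y0 hy0) (hk v hv)).symm

lemma all_C_zero {y0 : E n} (hy0 : y0 ≠ 0) (hnp : ¬ Pol F x y0) (y1 : E n) (hy1 : y1 ≠ 0) (v1 : E n) :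
    cB F x y1 v1 v1 v1 = 0 := by
  by_contra hc
  have S := setup hU hF
  have hN : ∀ᶠ y in 𝓝 y1, y ≠ 0 ∧ Pol F x y := by
    have h1 : ContinuousAt (fun y : E n => C3 (QQ F) (x, y, v1)) y1 := by
      have := (S.sC3.continuousOn.continuousAt (S.op.mem_nhds (mem_OO hU hF hx hy1 v1)))
      exact ContinuousAt.comp (g := C3 (QQ F)) (f := fun y : E n => ((x, y, v1) : T n)) this
        (by fun_prop)
    have h2 : C3 (QQ F) (x, y1, v1) ≠ 0 := by rw [cB_eq hU hF hx hy1]; exact hc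
    filter_upwards [h1.eventually_ne h2, isOpen_ne.mem_nhds hy1] with y h3 h4
    refine ⟨h4, ?_⟩
    by_contra h5
    apply h3
    rw [cB_eq hU hF hx h4]
    exact C_zero hn hU hF hsec hx h4 h5 v1
  have hz : ∀ v, aB F x y0 v v = 0 → rB F x y0 v v = 0 := by
    intro v hv
    rw [aB_zero hU hF hx hy0 hv]
    simp [rB_y hn hU hF hsec hx hy0]
  have key : ∀ v w, (v ≠ 0 ∧ Pol F x v) → (w ≠ 0 ∧ Pol F x w) →
      rB F x y0 v v * aB F x y0 w w = rB F x y0 w w * aB F x y0 v v := by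
    rintro v w ⟨hv, k, hk⟩ ⟨hw, k', hk'⟩
    by_cases h1 : aB F x y0 v v = 0
    · rw [h1, hz v h1]; simp
    by_cases h2 : aB F x y0 w w = 0
    · rw [h2, hz w h2]; simp
    have e1 := pol_one hn hU hF hsec hx ((aB_li hU hF hx hy0).2 h1) hk
    have e2 := pol_one hn hU hF hsec hx ((aB_li hU hF hx hy0).2 h2) hk'
    by_cases h3 : LinearIndependent ℝ ![v, w]
    · rw [e1, e2, pol_two hn hU hF hsec hx h3 hk hk']; ring
    · rw [LinearIndependent.pair_iff' hv] at h3
      push Not at h3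
      obtain ⟨s, rfl⟩ := h3
      simp only [map_smul, LinearMap.smul_apply, smul_eq_mul]
      ring
  have step : ∀ w, (w ≠ 0 ∧ Pol F x w) → ∀ v,
      rB F x y0 v v * aB F x y0 w w = rB F x y0 w w * aB F x y0 v v := by
    intro w hw v
    have := quad_zero ((aB F x y0 w w) • rB F x y0 - (rB F x y0 w w) • aB F x y0) y1 (by
      filter_upwards [hN] with u hu
      have := key u w hu hw
      simp only [LinearMap.sub_apply, LinearMap.smul_apply, smul_eq_mul]
      linarith) v
    simp only [LinearMap.sub_apply, LinearMap.smul_apply, smul_eq_mul] at this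
    linarith
  obtain ⟨v, w, hvw⟩ := not_pol hn hU hF hsec hx hy0 hnp
  apply hvw
  have := quad_zero ((rB F x y0 v v) • aB F x y0 - (aB F x y0 v v) • rB F x y0) y1 (by
      filter_upwards [hN] with u hu
      have := step u hu v
      simp only [LinearMap.sub_apply, LinearMap.smul_apply, smul_eq_mul]
      linarith) w
  simp only [LinearMap.sub_apply, LinearMap.smul_apply, smul_eq_mul] at this
  linarith

lemma eucl {y0 : E n} (hy0 : y0 ≠ 0) (hC : ∀ y, y ≠ 0 → ∀ v, cB F x y v v v = 0) {y : E n}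
    (hy : y ≠ 0) : (F x y) ^ 2 = ∑ i, ∑ j, gmat n F x y0 i j * y i * y j := by
  have S := setup hU hF
  have hd : ∀ z, z ≠ 0 → ∀ v w, fderiv ℝ (g2 (QQ F)) (x, z, v) (0, w, 0) = 0 := by
    intro z hz v w
    have hp := mem_OO hU hF hx hz v
    have h1 := linDiv (diffAt S.op S.sC3 hp) (diffAt S.op S.sA4 hp) (0 : E n →ₗ[ℝ] ℝ)
      (fun u => by
        have := cB_eq hU hF hx hz u
        rw [hC z hz] at this
        simpa using this) w
    rw [S.ZC3 hp] at h1
    simpa using h1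
  have hr : 1 < Module.rank ℝ (E n) := by
    rw [rank_fin_fun]
    exact_mod_cast hn
  have hconn := (isConnected_compl_singleton_of_one_lt_rank hr (0 : E n)).isPreconnected
  have hconst : g2 (QQ F) (x, y, y) = g2 (QQ F) (x, y0, y) := by
    have hdf : ∀ z, z ≠ 0 → DifferentiableAt ℝ (fun y' : E n => g2 (QQ F) (x, y', y)) z := by
      intro z hz
      have := diffAt S.op S.sg2 (mem_OO hU hF hx hz y)
      exact DifferentiableAt.comp (g := g2 (QQ F)) (f := fun y' : E n => ((x, y', y) : T n)) z this
        (by fun_prop)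
    refine isOpen_compl_singleton.is_const_of_fderiv_eq_zero (𝕜 := ℝ)
      (f := fun y' : E n => g2 (QQ F) (x, y', y)) hconn
      (fun z hz => (hdf z hz).differentiableWithinAt) ?_ hy hy0
    intro z hz
    ext1 w
    have := fdy_eq hU S.sg2 (mem_OO hU hF hx hz y) w
    rw [hd z hz] at this
    exact this
  rw [bB_eq hU hF hx hy, bB_eq hU hF hx hy0, bB_y hU hF hx hy, ell_y hU hF hx hy, bB, bil_apply] at hconst
  have h2 : ∑ l, ∑ m, y l * y m * pdy n (pdy n (F2 n F) l) m x y0 =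
      2 * ∑ i, ∑ j, gmat n F x y0 i j * y i * y j := by
    simp only [Finset.mul_sum]
    refine Finset.sum_congr rfl fun l _ => Finset.sum_congr rfl fun m _ => ?_
    rw [bB_gm hU hF hx hy0, gm_symm hU hF hx hy0]
    simp only [gmat, Matrix.of_apply]
    ring
  rw [h2] at hconst
  have : F2 n F x y = (F x y) ^ 2 := rfl
  linarith

end Final

/-- If a Finsler metric on an open set `U ⊆ ℝⁿ` (n ≥ 2) is of sectional
flag curvature, then at each point `x ∈ U` either the Minkowski norm `F(x,·)` is
Euclidean, or the flag curvature is isotropic at `x`. -/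
theorem sectional_flag_curvature_dichotomy (n : ℕ) (hn : 2 ≤ n)
    (U : Set (E n)) (hU : IsOpen U) (F : E n → E n → ℝ)
    (hF : IsFinsler n U F) (hsec : SectionalFlagCurv n U F) :
    ∀ x ∈ U,
      (∃ a : Matrix (Fin n) (Fin n) ℝ, a.IsSymm ∧ a.PosDef ∧
        ∀ y : E n, y ≠ 0 → (F x y) ^ 2 = ∑ i, ∑ j, a i j * y i * y j) ∨
      IsotropicAt n F x := by
  intro x hx
  by_cases h : ∀ y, y ≠ 0 → Pol F x y
  · exact Or.inr (iso_of_pol hn hU hF hsec hx h)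
  · left
    push Not at h
    obtain ⟨y0, hy0, hnp⟩ := h
    refine ⟨gmat n F x y0, ?_, hF.posdef x hx y0 hy0, fun y hy =>
      eucl hn hU hF hsec hx hy0 (fun z hz v => all_C_zero hn hU hF hsec hx hy0 hnp z hz v) hy⟩
    ext i j
    simp only [Matrix.transpose_apply, gmat, Matrix.of_apply]
    exact gm_symm hU hF hx hy0 j i

end Paper
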